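/- Let n and k be positive integers with n ≥ k+3, and let F be a family of meromorphic functions on a domain D ⊂ ℂ. If every f ∈ F satisfies (f^n)^{(k)}(z) ≠ 1 for all z ∈ D, then F is a normal family in D. -/

import Mathlib

open Complex Topology Filter Set MeasureTheory
open scoped ENNReal NNReal Classical

noncomputable section


/-- The chordal (spherical) distance on the Riemann sphere `ℂ ∪ {∞}`. -/
def sphDist (a b : OnePoint ℂ) : ℝ :=
  Option.elim a (Option.elim b 0 fun w => 1 / Real.sqrt (1 + ‖w‖ ^ 2))
    fun z => Option.elim b (1 / Real.sqrt (1 + ‖z‖ ^ 2))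
      fun w => ‖z - w‖ / (Real.sqrt (1 + ‖z‖ ^ 2) * Real.sqrt (1 + ‖w‖ ^ 2))

/-- The natural Riemann-sphere-valued version of a meromorphic function:
at points where the function blows up (poles) the value is `∞`. -/
def toSphere (f : ℂ → ℂ) : ℂ → OnePoint ℂ := fun z =>
  if Tendsto (fun w => ‖f w‖) (𝓝[≠] z) atTop then OnePoint.infty else (f z : OnePoint ℂ)

/-- A meromorphic function given by an honest representative: at each point of `D` it is
either continuous (analytic points) or blows up (a pole). -/
def MeromorphicNiceOn (f : ℂ → ℂ) (D : Set ℂ) : Prop :=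
  MeromorphicOn f D ∧ ∀ z ∈ D, ContinuousAt f z ∨ Tendsto (fun w => ‖f w‖) (𝓝[≠] z) atTop

/-- The order (multiplicity) of a meromorphic function at a point: positive for a zero of that
multiplicity, negative of the multiplicity for a pole, `⊤` if the function vanishes identically
near the point, and junk value `0` when not defined. -/
def merOrder (f : ℂ → ℂ) (z : ℂ) : WithTop ℤ :=
  if ∀ᶠ w in 𝓝[≠] z, f w = 0 then ⊤
  else if h : ∃ n : ℤ, ∃ g : ℂ → ℂ, AnalyticAt ℂ g z ∧ g z ≠ 0 ∧
      ∀ᶠ w in 𝓝[≠] z, f w = (w - z) ^ n * g w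
    then (h.choose : WithTop ℤ) else 0

/-- `F j → g` spherically uniformly on compact subsets of `D`. -/
def ConvSphLocUnif (F : ℕ → ℂ → ℂ) (g : ℂ → ℂ) (D : Set ℂ) : Prop :=
  ∀ K ⊆ D, IsCompact K → ∀ ε > 0, ∀ᶠ j in atTop, ∀ z ∈ K,
    sphDist (toSphere (F j) z) (toSphere g z) < ε

/-- `F j → ∞` spherically uniformly on compact subsets of `D`. -/
def ConvInftyLocUnif (F : ℕ → ℂ → ℂ) (D : Set ℂ) : Prop :=
  ∀ K ⊆ D, IsCompact K → ∀ ε > 0, ∀ᶠ j in atTop, ∀ z ∈ K,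
    sphDist (toSphere (F j) z) OnePoint.infty < ε

/-- A family of meromorphic functions is normal in `D` if every sequence from the family has a
subsequence converging spherically uniformly on compact subsets of `D` to a meromorphic
function or to `∞`. -/
def NormalFamilyOn (𝓕 : Set (ℂ → ℂ)) (D : Set ℂ) : Prop :=
  ∀ f : ℕ → ℂ → ℂ, (∀ j, f j ∈ 𝓕) → ∃ φ : ℕ → ℕ, StrictMono φ ∧
    ((∃ g : ℂ → ℂ, MeromorphicNiceOn g D ∧ ConvSphLocUnif (fun j => f (φ j)) g D) ∨
      ConvInftyLocUnif (fun j => f (φ j)) D)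

/-- A sequence of meromorphic functions is normal in `D` if every subsequence has a further
subsequence converging spherically uniformly on compact subsets of `D` to a meromorphic
function or to `∞`. -/
def NormalSeqOn (f : ℕ → ℂ → ℂ) (D : Set ℂ) : Prop :=
  ∀ φ : ℕ → ℕ, StrictMono φ → ∃ σ : ℕ → ℕ, StrictMono σ ∧
    ((∃ g : ℂ → ℂ, MeromorphicNiceOn g D ∧ ConvSphLocUnif (fun j => f (φ (σ j))) g D) ∨
      ConvInftyLocUnif (fun j => f (φ (σ j))) D)

/-! ### Pointwise estimates for logarithmic derivatives of entire functions -/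

lemma norm_le_of_norm_le_on_sphere {φ : ℂ → ℂ} (hφ : Differentiable ℂ φ) {R M : ℝ} (hR : 0 < R)
    (h : ∀ z, ‖z‖ = R → ‖φ z‖ ≤ M) {z : ℂ} (hz : ‖z‖ ≤ R) : ‖φ z‖ ≤ M := by
  refine norm_le_of_forall_mem_frontier_norm_le (U := Metric.ball 0 R) Metric.isBounded_ball
    hφ.diffContOnCl (fun w hw => h w ?_) ?_
  · rw [frontier_ball _ hR.ne'] at hw
    simpa using hw
  · rw [closure_ball _ hR.ne']
    simpa using hz

lemma norm_logDeriv_le_of_ne_zero {ψ : ℂ → ℂ} (hψ : Differentiable ℂ ψ) {r R S : ℝ} (hr : 0 < r)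
    (hrR : r < R) (hS : 0 < S) (hne : ∀ z ∈ Metric.ball (0 : ℂ) R, ψ z ≠ 0)
    (hb : ∀ z ∈ Metric.ball (0 : ℂ) R, ‖ψ z‖ ≤ Real.exp S * ‖ψ 0‖) {z : ℂ} (hz : ‖z‖ ≤ r) :
    ‖logDeriv ψ z‖ ≤ 8 * S * R / (R - r) ^ 2 := by
  have hR : 0 < R := hr.trans hrR
  have hψ0 : ψ 0 ≠ 0 := hne 0 (by simpa using hR)
  have hd : DifferentiableOn ℂ (logDeriv ψ) (Metric.ball 0 R) := by
    unfold logDeriv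
    refine DifferentiableOn.div ?_ hψ.differentiableOn hne
    exact ((hψ.differentiableOn (s := univ)).deriv isOpen_univ).mono (subset_univ _)
  obtain ⟨h, h0, hh⟩ := hd.isExactOn_ball.with_val_at 0 0
  have hconst : ∀ w ∈ Metric.ball (0 : ℂ) R, ψ w * Complex.exp (-h w) = ψ 0 := by
    intro w hw
    have hder : ∀ w ∈ Metric.ball (0 : ℂ) R,
        HasDerivAt (fun w => ψ w * Complex.exp (-h w)) 0 w := by
      intro w hw
      refine ((hψ w).hasDerivAt.mul (hh w hw).neg.cexp).congr_deriv ?_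
      have := hne w hw
      rw [logDeriv_apply]
      field_simp
      ring
    have := (convex_ball (0 : ℂ) R).is_const_of_fderivWithin_eq_zero (𝕜 := ℂ)
      (f := fun w => ψ w * Complex.exp (-h w))
      (fun w hw => (hder w hw).differentiableAt.differentiableWithinAt)
      (fun w hw => by
        rw [fderivWithin_of_isOpen Metric.isOpen_ball hw]
        ext; simpa using (hder w hw).deriv) hw (Metric.mem_ball_self hR)
    simpa [h0] using this
  have hre : MapsTo h (Metric.ball 0 R) {z | z.re ≤ S} := by
    intro w hw
    have h1 := hconst w hw
    have h2 : ‖ψ w‖ = ‖ψ 0‖ * Real.exp (h w).re := by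
      rw [← h1, norm_mul, Complex.norm_exp, mul_assoc, ← Real.exp_add]
      simp
    have h3 := hb w hw
    rw [h2, mul_comm] at h3
    exact Real.exp_le_exp.1 (le_of_mul_le_mul_right h3 (by positivity))
  have hdiff : DifferentiableOn ℂ h (Metric.ball 0 R) :=
    fun w hw => (hh w hw).differentiableAt.differentiableWithinAt
  set t := (R - r) / 2 with ht
  have ht0 : 0 < t := by simp only [ht]; linarith
  have hsub : ∀ w ∈ Metric.closedBall z t, ‖w‖ ≤ R - t := by
    intro w hw
    have h1 : ‖w‖ ≤ ‖w - z‖ + ‖z‖ := by simpa using norm_add_le (w - z) z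
    rw [Metric.mem_closedBall, dist_eq_norm] at hw
    simp only [ht] at *
    linarith
  have hcb : Metric.closedBall z t ⊆ Metric.ball 0 R := fun w hw => by
    have := hsub w hw
    simp only [Metric.mem_ball, dist_zero_right]; linarith
  have key : ‖deriv h z‖ ≤ 2 * S * R / t / t := by
    refine norm_deriv_le_of_forall_mem_sphere_norm_le ht0 ?_ ?_
    · exact ((hdiff.mono (by rw [closure_ball _ ht0.ne']; exact hcb)).diffContOnCl)
    · intro w hw
      have hw' := Metric.sphere_subset_closedBall hw
      have h1 := borelCaratheodory_zero hS hdiff hre hR (hcb hw') h0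
      have h2 := hsub w hw'
      refine h1.trans ?_
      gcongr
      · linarith
      · linarith
  have hz' : z ∈ Metric.ball (0 : ℂ) R := hcb (Metric.mem_closedBall_self ht0.le)
  rw [(hh z hz').deriv] at key
  refine key.trans (le_of_eq ?_)
  simp only [ht]
  have : R - r ≠ 0 := by linarith
  field_simp
  ring

lemma norm_logDeriv_list_prod_le {f : ℂ → ℂ → ℂ} {z : ℂ} {B : ℝ} (l : List ℂ)
    (hd : ∀ a ∈ l, DifferentiableAt ℂ (f a) z) (h0 : ∀ a ∈ l, f a z ≠ 0)
    (hB : ∀ a ∈ l, ‖logDeriv (f a) z‖ ≤ B) :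
    DifferentiableAt ℂ (fun w => (l.map fun a => f a w).prod) z ∧
      (l.map fun a => f a z).prod ≠ 0 ∧
      ‖logDeriv (fun w => (l.map fun a => f a w).prod) z‖ ≤ l.length * B := by
  induction l with
  | nil => simp [logDeriv_apply]
  | cons a l ih =>
    obtain ⟨h1, h2, h3⟩ := ih (fun b hb => hd b (List.mem_cons_of_mem _ hb))
      (fun b hb => h0 b (List.mem_cons_of_mem _ hb)) (fun b hb => hB b (List.mem_cons_of_mem _ hb))
    have ha : a ∈ a :: l := List.mem_cons_self
    simp only [List.map_cons, List.prod_cons, List.length_cons]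
    refine ⟨(hd a ha).mul h1, mul_ne_zero (h0 a ha) h2, ?_⟩
    rw [logDeriv_mul z (h0 a ha) h2 (hd a ha) h1]
    refine (norm_add_le _ _).trans ?_
    have := hB a ha
    push_cast
    linarith

lemma norm_list_prod_eq {f g : ℂ → ℂ} (l : List ℂ) (h : ∀ a ∈ l, ‖f a‖ = ‖g a‖) :
    ‖(l.map f).prod‖ = ‖(l.map g).prod‖ := by
  induction l with
  | nil => simp
  | cons a l ih =>
    simp only [List.map_cons, List.prod_cons, norm_mul]
    rw [h a List.mem_cons_self, ih fun b hb => h b (List.mem_cons_of_mem _ hb)]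

lemma norm_list_prod_le {f : ℂ → ℂ} {B : ℝ} (l : List ℂ) (h : ∀ a ∈ l, ‖f a‖ ≤ B) :
    ‖(l.map f).prod‖ ≤ B ^ l.length := by
  induction l with
  | nil => simp
  | cons a l ih =>
    simp only [List.map_cons, List.prod_cons, norm_mul, List.length_cons, pow_succ']
    have h1 := h a List.mem_cons_self
    have h2 := ih fun b hb => h b (List.mem_cons_of_mem _ hb)
    have := (norm_nonneg _).trans h1
    gcongr

lemma differentiable_list_prod {f : ℂ → ℂ → ℂ} (l : List ℂ)
    (hd : ∀ a ∈ l, Differentiable ℂ (f a)) :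
    Differentiable ℂ (fun w => (l.map fun a => f a w).prod) := by
  induction l with
  | nil => simp
  | cons a l ih =>
    simp only [List.map_cons, List.prod_cons]
    exact (hd a List.mem_cons_self).mul (ih fun b hb => hd b (List.mem_cons_of_mem _ hb))

/-- The cofactor of `∏ (z - a)` multiplied by the reflected factors `(R² - ā z) / R`. -/
def blaschkeCofactor (R : ℝ) (l : List ℂ) (ψ : ℂ → ℂ) (z : ℂ) : ℂ :=
  (l.map fun a => ((R : ℂ) ^ 2 - (starRingEnd ℂ) a * z) / R).prod * ψ z

lemma differentiable_blaschkeCofactor (R : ℝ) (l : List ℂ) {ψ : ℂ → ℂ} (hψ : Differentiable ℂ ψ) :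
    Differentiable ℂ (blaschkeCofactor R l ψ) :=
  (differentiable_list_prod l fun a _ => by fun_prop).mul hψ

lemma norm_blaschkeCofactor_eq {R : ℝ} (hR : 0 < R) {l : List ℂ} {φ ψ : ℂ → ℂ}
    (h : ∀ z, φ z = (l.map fun a => z - a).prod * ψ z) {z : ℂ} (hz : ‖z‖ = R) :
    ‖blaschkeCofactor R l ψ z‖ = ‖φ z‖ := by
  rw [h, blaschkeCofactor, norm_mul, norm_mul]
  congr 1
  refine norm_list_prod_eq l fun a _ => ?_
  have h1 : (R : ℂ) ^ 2 = (starRingEnd ℂ) z * z := by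
    rw [mul_comm, Complex.mul_conj, Complex.normSq_eq_norm_sq, hz]
    push_cast; rfl
  rw [h1, ← sub_mul, ← map_sub, norm_div, norm_mul, RCLike.norm_conj, hz, Complex.norm_real,
    Real.norm_of_nonneg hR.le]
  field_simp

lemma length_le_of_factorization {φ ψ : ℂ → ℂ} {l : List ℂ} {r d S : ℝ} (hr : 0 < r) (hd : 0 < d)
    (hd1 : d ≤ 1) (h0 : φ 0 ≠ 0) (hψ : Differentiable ℂ ψ)
    (hb : ∀ z, ‖z‖ ≤ r * (1 + d) → ‖φ z‖ ≤ Real.exp S * ‖φ 0‖)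
    (hl : ∀ a ∈ l, ‖a‖ ≤ r * (1 + d / 2))
    (h : ∀ z, φ z = (l.map fun a => z - a).prod * ψ z) :
    (∀ z, ‖z‖ ≤ r * (1 + d) → ‖blaschkeCofactor (r * (1 + d)) l ψ z‖ ≤ Real.exp S * ‖φ 0‖) ∧
    ‖φ 0‖ ≤ ‖blaschkeCofactor (r * (1 + d)) l ψ 0‖ ∧ (l.length : ℝ) ≤ 6 * S / d := by
  have hR : 0 < r * (1 + d) := by positivity
  have h1 : ∀ z, ‖z‖ ≤ r * (1 + d) →
      ‖blaschkeCofactor (r * (1 + d)) l ψ z‖ ≤ Real.exp S * ‖φ 0‖ := fun z hz =>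
    norm_le_of_norm_le_on_sphere (differentiable_blaschkeCofactor _ l hψ) hR
      (fun w hw => by rw [norm_blaschkeCofactor_eq hR h hw]; exact hb w hw.le) hz
  have h2 : ‖blaschkeCofactor (r * (1 + d)) l ψ 0‖ = (r * (1 + d)) ^ l.length * ‖ψ 0‖ := by
    have : (((r * (1 + d) : ℝ) : ℂ) ^ 2) / ((r * (1 + d) : ℝ) : ℂ) = ((r * (1 + d) : ℝ) : ℂ) := by
      have : ((r * (1 + d) : ℝ) : ℂ) ≠ 0 := by exact_mod_cast hR.ne'
      field_simp
    simp only [blaschkeCofactor, mul_zero, sub_zero, this, List.map_const', List.prod_replicate,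
      norm_mul, norm_pow, Complex.norm_real, Real.norm_of_nonneg hR.le]
  have h3 : ‖φ 0‖ ≤ (r * (1 + d / 2)) ^ l.length * ‖ψ 0‖ := by
    rw [h, norm_mul]
    gcongr
    exact norm_list_prod_le l fun a ha => by simpa using hl a ha
  have hexp : Real.exp (d / 6) * (r * (1 + d / 2)) ≤ r * (1 + d) := by
    have e1 : Real.exp (d / 6) ≤ 1 + d / 3 := by
      have := Real.add_one_le_exp (-(d / 6))
      rw [Real.exp_neg] at this
      have hp := Real.exp_pos (d / 6)
      have h4 : (-(d / 6) + 1) * Real.exp (d / 6) ≤ 1 := by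
        calc _ ≤ (Real.exp (d / 6))⁻¹ * Real.exp (d / 6) := by gcongr
          _ = 1 := by field_simp
      have h5 : 1 ≤ (-(d / 6) + 1) * (1 + d / 3) := by nlinarith
      exact le_of_mul_le_mul_left (h4.trans h5) (by linarith)
    calc _ ≤ (1 + d / 3) * (r * (1 + d / 2)) := by gcongr
      _ ≤ r * (1 + d) := by
        have : (1 + d / 3) * (1 + d / 2) ≤ 1 + d := by nlinarith
        nlinarith
  have hψ0 : 0 < ‖ψ 0‖ := norm_pos_iff.2 fun hh => h0 (by rw [h, hh, mul_zero])
  have hφ0 : 0 < ‖φ 0‖ := norm_pos_iff.2 h0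
  refine ⟨h1, ?_, ?_⟩
  · rw [h2]
    refine h3.trans ?_
    gcongr
    linarith
  · have h4 := h1 0 (by simpa using hR.le)
    have h5 : Real.exp (l.length * (d / 6)) * ‖φ 0‖ ≤ Real.exp S * ‖φ 0‖ := by
      refine le_trans ?_ h4
      rw [h2, Real.exp_nat_mul]
      calc _ ≤ Real.exp (d / 6) ^ l.length * ((r * (1 + d / 2)) ^ l.length * ‖ψ 0‖) := by gcongr
        _ = (Real.exp (d / 6) * (r * (1 + d / 2))) ^ l.length * ‖ψ 0‖ := by
          rw [mul_pow (Real.exp (d / 6)), mul_assoc]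
        _ ≤ _ := by gcongr
    have h6 := Real.exp_le_exp.1 (le_of_mul_le_mul_right h5 hφ0)
    rw [le_div_iff₀ hd]
    linarith

/-- An entire function of controlled growth factors as a polynomial times a function without
zeros on a given disc. -/
lemma exists_factorization {φ : ℂ → ℂ} {r d S : ℝ} (hφ : Differentiable ℂ φ) (hr : 0 < r)
    (hd : 0 < d) (hd1 : d ≤ 1) (h0 : φ 0 ≠ 0)
    (hb : ∀ z, ‖z‖ ≤ r * (1 + d) → ‖φ z‖ ≤ Real.exp S * ‖φ 0‖) :
    ∃ (l : List ℂ) (ψ : ℂ → ℂ), (∀ a ∈ l, ‖a‖ ≤ r * (1 + d / 2)) ∧ Differentiable ℂ ψ ∧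
      (∀ z, φ z = (l.map fun a => z - a).prod * ψ z) ∧
      ∀ z, ‖z‖ ≤ r * (1 + d / 2) → ψ z ≠ 0 := by
  by_contra! hcon
  have key : ∀ N : ℕ, ∃ (l : List ℂ) (ψ : ℂ → ℂ), l.length = N ∧
      (∀ a ∈ l, ‖a‖ ≤ r * (1 + d / 2)) ∧ Differentiable ℂ ψ ∧
      (∀ z, φ z = (l.map fun a => z - a).prod * ψ z) := by
    intro N
    induction N with
    | zero => exact ⟨[], φ, rfl, by simp, hφ, by simp⟩
    | succ N ih =>
      obtain ⟨l, ψ, h1, h2, h3, h4⟩ := ih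
      obtain ⟨a, ha, hψa⟩ := hcon l ψ h2 h3 h4
      refine ⟨a :: l, dslope ψ a, by simp [h1], ?_, ?_, ?_⟩
      · intro b hb
        rcases List.mem_cons.1 hb with rfl | hb
        · exact ha
        · exact h2 b hb
      · rw [← differentiableOn_univ] at h3 ⊢
        exact (Complex.differentiableOn_dslope univ_mem).2 h3
      · intro z
        have := sub_smul_dslope ψ a z
        rw [hψa, sub_zero, smul_eq_mul] at this
        rw [h4, ← this, List.map_cons, List.prod_cons]
        ring
  obtain ⟨N, hN⟩ := exists_nat_gt (6 * S / d)
  obtain ⟨l, ψ, h1, h2, h3, h4⟩ := key N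
  have := (length_le_of_factorization hr hd hd1 h0 h3 hb h2 h4).2.2
  rw [h1] at this
  linarith

/-- Pointwise form of the lemma on the logarithmic derivative. -/
lemma exists_norm_logDeriv_le {φ : ℂ → ℂ} {r d S : ℝ} (hφ : Differentiable ℂ φ) (hr : 1 ≤ r)
    (hd : 0 < d) (hd1 : d ≤ 1) (hS : 1 ≤ S) (h0 : φ 0 ≠ 0)
    (hb : ∀ z, ‖z‖ ≤ r * (1 + d) → ‖φ z‖ ≤ Real.exp S * ‖φ 0‖) :
    ∃ l : List ℂ, (l.length : ℝ) ≤ 6 * S / d ∧ ∀ δ, 0 < δ → δ ≤ 1 → ∀ z, ‖z‖ ≤ r →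
      (∀ a ∈ l, δ ≤ ‖z - a‖) → φ z ≠ 0 ∧ ‖logDeriv φ z‖ ≤ 60 * S / (d ^ 2 * δ) := by
  have hr0 : 0 < r := by linarith
  obtain ⟨l, ψ, hl, hψ, hfac, hne⟩ := exists_factorization hφ hr0 hd hd1 h0 hb
  obtain ⟨hB1, hB2, hlen⟩ := length_le_of_factorization hr0 hd hd1 h0 hψ hb hl hfac
  refine ⟨l, hlen, fun δ hδ hδ1 z hz hza => ?_⟩
  set R := r * (1 + d) with hRdef
  have hR : 0 < R := by positivity
  have hRC : (R : ℂ) ≠ 0 := by exact_mod_cast hR.ne'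
  have hrr : r < r * (1 + d / 2) := by nlinarith
  have hlow : ∀ a ∈ l, ∀ w, ‖w‖ ≤ r * (1 + d / 2) →
      0 < ‖(R : ℂ) ^ 2 - (starRingEnd ℂ) a * w‖ ∧
      R ^ 2 - r * (1 + d / 2) * ‖w‖ ≤ ‖(R : ℂ) ^ 2 - (starRingEnd ℂ) a * w‖ := by
    intro a ha w hw
    have h1 : R ^ 2 - r * (1 + d / 2) * ‖w‖ ≤ ‖(R : ℂ) ^ 2 - (starRingEnd ℂ) a * w‖ := by
      refine le_trans ?_ (norm_sub_norm_le _ _)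
      rw [norm_pow, norm_mul, RCLike.norm_conj, Complex.norm_real, Real.norm_of_nonneg hR.le]
      have := hl a ha
      gcongr
    refine ⟨lt_of_lt_of_le ?_ h1, h1⟩
    have h2 : r * (1 + d / 2) < R := by simp only [hRdef]; nlinarith
    have h3 : 0 < r * (1 + d / 2) := by positivity
    nlinarith [norm_nonneg w]
  have hBdiff := differentiable_blaschkeCofactor R l hψ
  have hψB : ‖logDeriv (blaschkeCofactor R l ψ) z‖ ≤
      8 * S * (r * (1 + d / 2)) / (r * (1 + d / 2) - r) ^ 2 := by
    refine norm_logDeriv_le_of_ne_zero hBdiff hr0 hrr (by linarith) ?_ ?_ hz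
    · intro w hw
      have hw' : ‖w‖ ≤ r * (1 + d / 2) := by simpa using (Metric.mem_ball.1 hw).le
      refine mul_ne_zero (List.prod_ne_zero ?_) (hne w hw')
      intro h
      obtain ⟨a, ha, h⟩ := List.mem_map.1 h
      rw [div_eq_zero_iff] at h
      rcases h with h | h
      · have := (hlow a ha w hw').1
        rw [h] at this
        simp at this
      · exact hRC h
    · intro w hw
      have hw' : ‖w‖ ≤ r * (1 + d / 2) := by simpa using (Metric.mem_ball.1 hw).le
      refine (hB1 w (hw'.trans ?_)).trans ?_
      · simp only [hRdef]; nlinarith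
      · gcongr
  have hfa : ∀ a ∈ l, z - a ≠ 0 := fun a ha h => by
    have := hza a ha
    rw [h, norm_zero] at this; linarith
  have hψz := hne z (hz.trans hrr.le)
  obtain ⟨p1, p2, p3⟩ := norm_logDeriv_list_prod_le (f := fun a w => w - a) (z := z) (B := 1 / δ) l
    (fun a _ => by fun_prop) hfa (fun a ha => by
      have : logDeriv (fun w : ℂ => w - a) z = 1 / (z - a) := by
        rw [logDeriv_apply]; simp
      rw [this, norm_div, norm_one]
      exact one_div_le_one_div_of_le hδ (hza a ha))
  obtain ⟨q1, q2, q3⟩ := norm_logDeriv_list_prod_le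
    (f := fun a w => ((R : ℂ) ^ 2 - (starRingEnd ℂ) a * w) / R) (z := z) (B := 1 / d) l
    (fun a _ => by fun_prop)
    (fun a ha => div_ne_zero (norm_pos_iff.1 (hlow a ha z (hz.trans hrr.le)).1) hRC)
    (fun a ha => by
      have hder : HasDerivAt (fun w : ℂ => ((R : ℂ) ^ 2 - (starRingEnd ℂ) a * w) / R)
          (-(starRingEnd ℂ a) / R) z := by
        have := (((hasDerivAt_id z).const_mul ((starRingEnd ℂ) a)).const_sub
          ((R : ℂ) ^ 2)).div_const (R : ℂ)
        simpa using this
      obtain ⟨hp, hp'⟩ := hlow a ha z (hz.trans hrr.le)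
      have e : logDeriv (fun w : ℂ => ((R : ℂ) ^ 2 - (starRingEnd ℂ) a * w) / R) z =
          -(starRingEnd ℂ a) / ((R : ℂ) ^ 2 - (starRingEnd ℂ) a * z) := by
        rw [logDeriv_apply, hder.deriv]
        have := norm_pos_iff.1 hp
        field_simp
      rw [e, norm_div, norm_neg, RCLike.norm_conj, div_le_div_iff₀ hp hd, one_mul]
      have h5 : R ^ 2 - r * (1 + d / 2) * r ≤ R ^ 2 - r * (1 + d / 2) * ‖z‖ := by gcongr
      have h6 := hl a ha
      have h7 : ‖a‖ * d ≤ r * (1 + d / 2) * d := by gcongr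
      have h8 : r * (1 + d / 2) * d ≤ R ^ 2 - r * (1 + d / 2) * r := by
        simp only [hRdef]
        have : r * (1 + d / 2) * d ≤ r ^ 2 * (1 + d / 2) * d := by
          have : r ≤ r ^ 2 := by nlinarith
          gcongr
        nlinarith [mul_pos (mul_pos hr0 hr0) hd, mul_pos (mul_pos (mul_pos hr0 hr0) hd) hd]
      linarith)
  have hφz : φ z ≠ 0 := by rw [hfac]; exact mul_ne_zero p2 hψz
  refine ⟨hφz, ?_⟩
  have e1 : logDeriv φ z = logDeriv (fun w => (l.map fun a => w - a).prod) z + logDeriv ψ z := by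
    have : φ = fun z => (l.map fun a => z - a).prod * ψ z := funext hfac
    rw [this, logDeriv_mul z p2 hψz p1 (hψ z)]
  have e2 : logDeriv (blaschkeCofactor R l ψ) z =
      logDeriv (fun w => (l.map fun a => ((R : ℂ) ^ 2 - (starRingEnd ℂ) a * w) / R).prod) z
        + logDeriv ψ z := by
    unfold blaschkeCofactor
    rw [logDeriv_mul z q2 hψz q1 (hψ z)]
  have e3 : logDeriv φ z = logDeriv (fun w => (l.map fun a => w - a).prod) z
      + (logDeriv (blaschkeCofactor R l ψ) z
      - logDeriv (fun w => (l.map fun a => ((R : ℂ) ^ 2 - (starRingEnd ℂ) a * w) / R).prod) z) := by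
    rw [e1, e2]; ring
  rw [e3]
  refine (norm_add_le _ _).trans ((add_le_add le_rfl (norm_sub_le _ _)).trans ?_)
  have f1 : (l.length : ℝ) * (1 / δ) ≤ 6 * S / (d ^ 2 * δ) := by
    calc (l.length : ℝ) * (1 / δ) ≤ 6 * S / d * (1 / δ) := by gcongr
      _ = 6 * S / (d * δ) := by field_simp
      _ ≤ 6 * S / (d ^ 2 * δ) := by gcongr; nlinarith
  have f2 : (l.length : ℝ) * (1 / d) ≤ 6 * S / (d ^ 2 * δ) := by
    calc (l.length : ℝ) * (1 / d) ≤ 6 * S / d * (1 / d) := by gcongr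
      _ = 6 * S / (d ^ 2 * 1) := by field_simp
      _ ≤ 6 * S / (d ^ 2 * δ) := by gcongr
  have f3 : 8 * S * (r * (1 + d / 2)) / (r * (1 + d / 2) - r) ^ 2 ≤ 48 * S / (d ^ 2 * δ) := by
    have : 8 * S * (r * (1 + d / 2)) / (r * (1 + d / 2) - r) ^ 2 =
        32 * S * (1 + d / 2) / (r * d ^ 2) := by
      have e : r * (1 + d / 2) - r = r * d / 2 := by ring
      rw [e]
      field_simp
      norm_num
    rw [this]
    have : 32 * S * (1 + d / 2) ≤ 48 * S := by nlinarith
    have : d ^ 2 * δ ≤ r * d ^ 2 := by nlinarith [sq_nonneg d, mul_pos hd hd]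
    gcongr
  have f4 : 6 * S / (d ^ 2 * δ) + (48 * S / (d ^ 2 * δ) + 6 * S / (d ^ 2 * δ)) =
      60 * S / (d ^ 2 * δ) := by ring
  linarith

/-! ### Growth of entire functions -/

lemma exists_radius_avoiding (A : Finset ℂ) {r d : ℝ} (hr : 1 ≤ r) (hd : 0 < d) :
    ∃ ρ, r ≤ ρ ∧ ρ ≤ r * (1 + d) ∧ ∀ a ∈ A, ∀ z : ℂ, ‖z‖ = ρ →
      d / (2 * (A.card + 1)) ≤ ‖z - a‖ := by
  by_contra! hcon
  have hT : (0 : ℝ) < A.card + 1 := by positivity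
  set e := d / (2 * (A.card + 1 : ℝ)) with he
  have he0 : 0 < e := by positivity
  have hed : e * (2 * (A.card + 1)) = d := by rw [he]; field_simp
  have h1 : ∀ i : ℕ, ∃ a ∈ A, i < A.card + 1 → |r + e * (2 * i + 1) - ‖a‖| < e := by
    intro i
    have hA : A.Nonempty := by
      obtain ⟨a, ha, -⟩ := hcon r le_rfl (by nlinarith)
      exact ⟨a, ha⟩
    by_cases hi : i < A.card + 1
    · have hi' : (i : ℝ) + 1 ≤ A.card + 1 := by exact_mod_cast hi
      obtain ⟨a, ha, z, hz, hlt⟩ := hcon (r + e * (2 * i + 1)) (by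
          have : 0 ≤ e * (2 * i + 1) := by positivity
          linarith) (by
          have : e * (2 * i + 1) ≤ e * (2 * (A.card + 1)) := by gcongr; linarith
          nlinarith)
      refine ⟨a, ha, fun _ => ?_⟩
      rw [← hz]
      exact (abs_norm_sub_norm_le z a).trans_lt hlt
    · exact ⟨hA.choose, hA.choose_spec, fun h => absurd h hi⟩
  choose a haA ha using h1
  have hcard : A.card < (Finset.range (A.card + 1)).card := by simp
  obtain ⟨i, hi, j, hj, hij, haij⟩ :=
    Finset.exists_ne_map_eq_of_card_lt_of_maps_to hcard (fun i _ => haA i)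
  have hi' := ha i (Finset.mem_range.1 hi)
  have hj' := ha j (Finset.mem_range.1 hj)
  rw [haij] at hi'
  rw [abs_lt] at hi' hj'
  rcases lt_or_gt_of_ne hij with h | h
  · have : (i : ℝ) + 1 ≤ j := by exact_mod_cast h
    nlinarith
  · have : (j : ℝ) + 1 ≤ i := by exact_mod_cast h
    nlinarith

/-- Borel's growth lemma. -/
lemma exists_borel_radius {V : ℝ → ℝ} (hV : Monotone V) (hV1 : ∀ r, 1 ≤ V r) {r₀ : ℝ}
    (hr₀ : 1 ≤ r₀) : ∃ r, r₀ ≤ r ∧ V (r * (1 + 1 / V r)) ≤ 2 * V r := by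
  by_contra! hcon
  have key : ∀ m : ℕ, ∃ r, r₀ ≤ r ∧ 2 ^ m ≤ V r ∧ r ≤ r₀ * Real.exp (2 - 2 / 2 ^ m) := by
    intro m
    induction m with
    | zero => exact ⟨r₀, le_rfl, by simpa using hV1 r₀, by simp⟩
    | succ m ih =>
      obtain ⟨r, h1, h2, h3⟩ := ih
      have hVp : 0 < V r := by linarith [hV1 r]
      have hq : 0 ≤ 1 / V r := by positivity
      refine ⟨r * (1 + 1 / V r), by nlinarith, ?_, ?_⟩
      · have := hcon r h1
        rw [pow_succ]
        linarith
      · have h4 : 1 + 1 / V r ≤ Real.exp (1 / 2 ^ m) := by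
          have := Real.add_one_le_exp ((1 : ℝ) / 2 ^ m)
          have h5 : 1 / V r ≤ 1 / 2 ^ m := by gcongr
          linarith
        calc r * (1 + 1 / V r) ≤ r₀ * Real.exp (2 - 2 / 2 ^ m) * Real.exp (1 / 2 ^ m) := by
              gcongr
          _ = r₀ * Real.exp (2 - 2 / 2 ^ (m + 1)) := by
              rw [mul_assoc, ← Real.exp_add]
              congr 2
              rw [pow_succ]
              field_simp
              ring
  obtain ⟨m, hm⟩ := pow_unbounded_of_one_lt (V (r₀ * Real.exp 2)) (one_lt_two)
  obtain ⟨r, -, h2, h3⟩ := key m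
  have : V r ≤ V (r₀ * Real.exp 2) := by
    refine hV (h3.trans ?_)
    gcongr
    have : (0 : ℝ) ≤ 2 / 2 ^ m := by positivity
    linarith
  linarith

/-- Entire functions whose growth is controlled by `V`. -/
def GrowthControlled (V : ℝ → ℝ) (φ : ℂ → ℂ) : Prop :=
  Differentiable ℂ φ ∧ ∃ C : ℝ, 1 ≤ C ∧ ∀ r d : ℝ, 1 ≤ r → 0 < d → d ≤ 1 → ∀ z, ‖z‖ ≤ r →
    ‖φ z‖ ≤ Real.exp (C * (V (r * (1 + d)) / d))

namespace GrowthControlled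

variable {V : ℝ → ℝ} {φ χ : ℂ → ℂ}

lemma one_le_div (hV1 : ∀ r, 1 ≤ V r) {r d : ℝ} (hd : 0 < d) (hd1 : d ≤ 1) : 1 ≤ V r / d := by
  rw [le_div_iff₀ hd]
  linarith [hV1 r]

lemma const (hV1 : ∀ r, 1 ≤ V r) (c : ℂ) : GrowthControlled V fun _ => c := by
  refine ⟨by fun_prop, 1 + ‖c‖, by simp, fun r d hr hd hd1 z hz => ?_⟩
  have h1 := one_le_div hV1 (r := r * (1 + d)) hd hd1
  have h2 := Real.add_one_le_exp ((1 + ‖c‖) * (V (r * (1 + d)) / d))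
  nlinarith [norm_nonneg c]

lemma mul (h1 : GrowthControlled V φ) (h2 : GrowthControlled V χ) :
    GrowthControlled V fun z => φ z * χ z := by
  obtain ⟨d1, C1, hC1, h1⟩ := h1
  obtain ⟨d2, C2, hC2, h2⟩ := h2
  refine ⟨d1.mul d2, C1 + C2, by linarith, fun r d hr hd hd1 z hz => ?_⟩
  rw [norm_mul, add_mul, Real.exp_add]
  gcongr
  · exact h1 r d hr hd hd1 z hz
  · exact h2 r d hr hd hd1 z hz

lemma add (hV1 : ∀ r, 1 ≤ V r) (h1 : GrowthControlled V φ) (h2 : GrowthControlled V χ) :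
    GrowthControlled V fun z => φ z + χ z := by
  obtain ⟨d1, C1, hC1, h1⟩ := h1
  obtain ⟨d2, C2, hC2, h2⟩ := h2
  refine ⟨d1.add d2, 1 + C1 + C2, by linarith, fun r d hr hd hd1 z hz => ?_⟩
  have e1 := h1 r d hr hd hd1 z hz
  have e2 := h2 r d hr hd hd1 z hz
  have hX := one_le_div hV1 (r := r * (1 + d)) hd hd1
  set X := V (r * (1 + d)) / d
  rw [add_mul, add_mul, one_mul, Real.exp_add, Real.exp_add]
  have f1 : 2 ≤ Real.exp X := by linarith [Real.add_one_le_exp X]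
  have f2 : 1 ≤ Real.exp (C1 * X) := Real.one_le_exp (by positivity)
  have f3 : 1 ≤ Real.exp (C2 * X) := Real.one_le_exp (by positivity)
  refine (norm_add_le _ _).trans ?_
  have : Real.exp (C1 * X) + Real.exp (C2 * X) ≤ 2 * Real.exp (C1 * X) * Real.exp (C2 * X) := by
    nlinarith
  refine (add_le_add e1 e2).trans (this.trans ?_)
  gcongr

lemma sub (hV1 : ∀ r, 1 ≤ V r) (h1 : GrowthControlled V φ) (h2 : GrowthControlled V χ) :
    GrowthControlled V fun z => φ z - χ z := by
  simpa [sub_eq_add_neg] using h1.add hV1 ((const hV1 (-1)).mul h2)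

lemma pow (hV1 : ∀ r, 1 ≤ V r) (h : GrowthControlled V φ) (m : ℕ) :
    GrowthControlled V fun z => φ z ^ m := by
  induction m with
  | zero => simpa using const hV1 1
  | succ m ih => simpa [pow_succ] using ih.mul h

lemma deriv (hV : Monotone V) (hV1 : ∀ r, 1 ≤ V r) (h : GrowthControlled V φ) :
    GrowthControlled V (_root_.deriv φ) := by
  obtain ⟨hd, C, hC, h⟩ := h
  refine ⟨?_, 3 * C + 3, by linarith, fun r d hr hd0 hd1 z hz => ?_⟩
  · rw [← differentiableOn_univ] at hd ⊢
    exact hd.deriv isOpen_univ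
  have hX := one_le_div hV1 (r := r * (1 + d)) hd0 hd1
  have key : ‖_root_.deriv φ z‖ ≤ Real.exp (3 * C * (V (r * (1 + d)) / d)) / (d / 3) := by
    refine norm_deriv_le_of_forall_mem_sphere_norm_le (by positivity) hd.diffContOnCl ?_
    intro w hw
    have hw' : ‖w‖ ≤ r * (1 + d / 3) := by
      rw [mem_sphere_iff_norm] at hw
      have := norm_add_le (w - z) z
      rw [sub_add_cancel] at this
      nlinarith
    refine (h (r * (1 + d / 3)) (d / 3) (by nlinarith) (by positivity) (by linarith) w hw').trans ?_
    have e : C * (V (r * (1 + d / 3) * (1 + d / 3)) / (d / 3)) =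
        3 * C * (V (r * (1 + d / 3) * (1 + d / 3)) / d) := by field_simp
    rw [e]
    gcongr
    apply hV
    have : (1 + d / 3) * (1 + d / 3) ≤ 1 + d := by nlinarith
    nlinarith
  refine key.trans ?_
  rw [add_mul, Real.exp_add, div_eq_mul_inv]
  gcongr
  rw [inv_div]
  have : 3 / d ≤ 3 * (V (r * (1 + d)) / d) := by
    rw [← mul_div_assoc]
    gcongr
    linarith [hV1 (r * (1 + d))]
  linarith [Real.add_one_le_exp (3 * (V (r * (1 + d)) / d))]

end GrowthControlled

/-- Simultaneous logarithmic derivative estimate on a well-chosen circle. -/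
lemma exists_circle_norm_logDeriv_le {V : ℝ → ℝ} (hV : Monotone V) (hV1 : ∀ r, 1 ≤ V r)
    (m : ℕ) {φ : ℕ → ℂ → ℂ} (hφ : ∀ i < m, GrowthControlled V (φ i)) (h0 : ∀ i < m, φ i 0 ≠ 0) :
    ∃ K : ℝ, 1 ≤ K ∧ ∀ r d : ℝ, 1 ≤ r → 0 < d → d ≤ 1 → ∃ ρ, r ≤ ρ ∧ ∀ i < m, ∀ z, ‖z‖ = ρ →
      φ i z ≠ 0 ∧ ‖logDeriv (φ i) z‖ ≤ K * (V (r * (1 + 7 * d)) / d) ^ 6 := by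
  have hC : ∃ C : ℝ, 1 ≤ C ∧ ∀ i < m, ∀ r d : ℝ, 1 ≤ r → 0 < d → d ≤ 1 → ∀ z, ‖z‖ ≤ r →
      ‖φ i z‖ ≤ Real.exp (C * (V (r * (1 + d)) / d)) * ‖φ i 0‖ := by
    induction m with
    | zero => exact ⟨1, le_rfl, by simp⟩
    | succ m ih =>
      obtain ⟨C, hC1, hC⟩ := ih (fun i hi => hφ i (by omega)) (fun i hi => h0 i (by omega))
      obtain ⟨-, C', hC1', hC'⟩ := hφ m (by omega)
      have hpos : 0 < ‖φ m 0‖ := norm_pos_iff.2 (h0 m (by omega))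
      have habs := abs_nonneg (Real.log ‖φ m 0‖)
      refine ⟨C + C' + |Real.log ‖φ m 0‖|, by linarith, fun i hi r d hr hd hd1 z hz => ?_⟩
      have hX := GrowthControlled.one_le_div hV1 (r := r * (1 + d)) hd hd1
      rcases Nat.lt_succ_iff_lt_or_eq.1 hi with hi | rfl
      · refine (hC i hi r d hr hd hd1 z hz).trans ?_
        gcongr
        linarith
      · refine (hC' r d hr hd hd1 z hz).trans ?_
        rw [← Real.exp_log hpos, ← Real.exp_add, Real.exp_log hpos]
        gcongr
        have := neg_abs_le (Real.log ‖φ i 0‖)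
        nlinarith
  obtain ⟨C, hC1, hC⟩ := hC
  refine ⟨840 * C ^ 2 * (m + 1), by nlinarith [(Nat.cast_nonneg m : (0 : ℝ) ≤ m)],
    fun r d hr hd hd1 => ?_⟩
  set X := V (r * (1 + 7 * d)) / d with hXdef
  have hX : 1 ≤ X := GrowthControlled.one_le_div hV1 hd hd1
  have hS1 : 1 ≤ C * X := by nlinarith
  have hl : ∀ i, ∃ l : List ℂ, i < m → (l.length : ℝ) ≤ 6 * (C * X) / d ∧
      ∀ δ, 0 < δ → δ ≤ 1 → ∀ z, ‖z‖ ≤ r * (1 + d) →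
      (∀ a ∈ l, δ ≤ ‖z - a‖) → φ i z ≠ 0 ∧ ‖logDeriv (φ i) z‖ ≤ 60 * (C * X) / (d ^ 2 * δ) := by
    intro i
    have hRR : 1 ≤ r * (1 + d) * (1 + d) := by
      have : 1 ≤ r * (1 + d) := by nlinarith
      nlinarith
    by_cases hi : i < m
    · obtain ⟨l, hl⟩ := exists_norm_logDeriv_le (hφ i hi).1 (r := r * (1 + d)) (by nlinarith)
        hd hd1 hS1 (h0 i hi) (fun z hz => by
          refine (hC i hi _ d hRR hd hd1 z hz).trans ?_
          gcongr
          simp only [hXdef]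
          refine div_le_div_of_nonneg_right (hV ?_) hd.le
          have : (1 + d) * (1 + d) * (1 + d) ≤ 1 + 7 * d := by
            nlinarith [mul_nonneg hd.le (sub_nonneg.2 hd1), mul_nonneg (mul_nonneg hd.le hd.le)
              (sub_nonneg.2 hd1)]
          calc r * (1 + d) * (1 + d) * (1 + d) = r * ((1 + d) * (1 + d) * (1 + d)) := by ring
            _ ≤ _ := by gcongr)
      exact ⟨l, fun _ => hl⟩
    · exact ⟨[], fun h => absurd h hi⟩
  choose l hl using hl
  set A : Finset ℂ := (Finset.range m).biUnion fun i => (l i).toFinset with hA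
  have hcard : (A.card : ℝ) ≤ m * (6 * (C * X) / d) := by
    have h1 : A.card ≤ ∑ i ∈ Finset.range m, (l i).length :=
      Finset.card_biUnion_le.trans (Finset.sum_le_sum fun i _ => List.toFinset_card_le _)
    have h2 : (A.card : ℝ) ≤ ∑ i ∈ Finset.range m, ((l i).length : ℝ) := by exact_mod_cast h1
    refine h2.trans ((Finset.sum_le_sum fun i hi => (hl i (Finset.mem_range.1 hi)).1).trans ?_)
    simp
  obtain ⟨ρ, hρ1, hρ2, hρ⟩ := exists_radius_avoiding A hr hd
  refine ⟨ρ, hρ1, fun i hi z hz => ?_⟩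
  have hT : (0 : ℝ) < A.card + 1 := by positivity
  obtain ⟨h1, h2⟩ := (hl i hi).2 (d / (2 * (A.card + 1))) (by positivity) (by
      rw [div_le_one (by positivity)]
      have : (0 : ℝ) ≤ A.card := by positivity
      linarith) z (hz.le.trans hρ2) (fun a ha => hρ a (by
      rw [hA, Finset.mem_biUnion]
      exact ⟨i, Finset.mem_range.2 hi, List.mem_toFinset.2 ha⟩) z hz)
  refine ⟨h1, h2.trans ?_⟩
  have hdX : 1 / d ≤ X := by
    rw [hXdef]
    gcongr
    exact hV1 _
  have e1 : (A.card : ℝ) + 1 ≤ 7 * C * (m + 1) * X ^ 2 := by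
    have : m * (6 * (C * X) / d) ≤ m * (6 * C * X * X) := by
      gcongr
      calc 6 * (C * X) / d = 6 * C * X * (1 / d) := by ring
        _ ≤ _ := by gcongr
    have h3 : 1 ≤ C * X ^ 2 := by nlinarith
    have h4 : (0 : ℝ) ≤ m := by positivity
    nlinarith [mul_nonneg h4 (by positivity : 0 ≤ C * X ^ 2)]
  calc 60 * (C * X) / (d ^ 2 * (d / (2 * (A.card + 1))))
      = 120 * C * X * (A.card + 1) * (1 / d) ^ 3 := by field_simp; norm_num
    _ ≤ 120 * C * X * (7 * C * (m + 1) * X ^ 2) * X ^ 3 := by gcongr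
    _ = _ := by ring

/-- A monotone majorant of the logarithmic growth of a pair of functions. -/
def pairGrowth (p q : ℂ → ℂ) (r : ℝ) : ℝ :=
  1 + Real.log (1 + sSup ((fun z => ‖p z‖ + ‖q z‖) '' Metric.closedBall 0 r))

section pairGrowth

variable {p q : ℂ → ℂ}

lemma pairGrowth_sSup_nonneg (p q : ℂ → ℂ) (r : ℝ) :
    0 ≤ sSup ((fun z => ‖p z‖ + ‖q z‖) '' Metric.closedBall 0 r) := by
  refine Real.sSup_nonneg ?_
  rintro _ ⟨z, -, rfl⟩
  positivity

lemma one_le_pairGrowth (p q : ℂ → ℂ) (r : ℝ) : 1 ≤ pairGrowth p q r := by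
  have := Real.log_nonneg (by linarith [pairGrowth_sSup_nonneg p q r] :
    1 ≤ 1 + sSup ((fun z => ‖p z‖ + ‖q z‖) '' Metric.closedBall 0 r))
  unfold pairGrowth
  linarith

lemma bddAbove_pairGrowth (hp : Differentiable ℂ p) (hq : Differentiable ℂ q) (r : ℝ) :
    BddAbove ((fun z => ‖p z‖ + ‖q z‖) '' Metric.closedBall 0 r) :=
  ((isCompact_closedBall _ _).image (hp.continuous.norm.add hq.continuous.norm)).bddAbove

lemma monotone_pairGrowth (hp : Differentiable ℂ p) (hq : Differentiable ℂ q) :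
    Monotone (pairGrowth p q) := by
  intro r s hrs
  unfold pairGrowth
  have h := pairGrowth_sSup_nonneg p q r
  refine add_le_add le_rfl (Real.log_le_log (by linarith) (add_le_add le_rfl ?_))
  rcases (Metric.closedBall (0 : ℂ) r).eq_empty_or_nonempty with he | hne
  · rw [he]
    simpa using pairGrowth_sSup_nonneg p q s
  · exact csSup_le_csSup (bddAbove_pairGrowth hp hq s) (hne.image _)
      (image_mono (Metric.closedBall_subset_closedBall hrs))

lemma norm_add_norm_le_exp_pairGrowth (hp : Differentiable ℂ p) (hq : Differentiable ℂ q) {r : ℝ}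
    {z : ℂ} (hz : ‖z‖ ≤ r) : ‖p z‖ + ‖q z‖ ≤ Real.exp (pairGrowth p q r) := by
  have h := pairGrowth_sSup_nonneg p q r
  have h1 : ‖p z‖ + ‖q z‖ ≤ sSup ((fun z => ‖p z‖ + ‖q z‖) '' Metric.closedBall 0 r) :=
    le_csSup (bddAbove_pairGrowth hp hq r) ⟨z, by simpa using hz, rfl⟩
  unfold pairGrowth
  rw [Real.exp_add, Real.exp_log (by linarith)]
  have : 1 ≤ Real.exp 1 := Real.one_le_exp zero_le_one
  nlinarith

lemma growthControlled_of_pairGrowth (hp : Differentiable ℂ p) (hq : Differentiable ℂ q) :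
    GrowthControlled (pairGrowth p q) p ∧ GrowthControlled (pairGrowth p q) q := by
  have key : ∀ r d : ℝ, 1 ≤ r → 0 < d → d ≤ 1 → ∀ z : ℂ, ‖z‖ ≤ r →
      ‖p z‖ + ‖q z‖ ≤ Real.exp (1 * (pairGrowth p q (r * (1 + d)) / d)) := by
    intro r d hr hd hd1 z hz
    refine (norm_add_norm_le_exp_pairGrowth hp hq hz).trans ?_
    gcongr
    have h1 : pairGrowth p q r ≤ pairGrowth p q (r * (1 + d)) :=
      monotone_pairGrowth hp hq (by nlinarith)
    rw [one_mul, le_div_iff₀ hd]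
    nlinarith [one_le_pairGrowth p q r]
  exact ⟨⟨hp, 1, le_rfl, fun r d hr hd hd1 z hz =>
    (le_add_of_nonneg_right (norm_nonneg _)).trans (key r d hr hd hd1 z hz)⟩,
    ⟨hq, 1, le_rfl, fun r d hr hd hd1 z hz =>
    (le_add_of_nonneg_left (norm_nonneg _)).trans (key r d hr hd hd1 z hz)⟩⟩

lemma exists_bound_of_le_log (C N : ℝ) : ∃ B : ℝ, ∀ x : ℝ, 1 ≤ x → x ≤ C + N * Real.log x →
    x ≤ B := by
  have h1 := (Real.isLittleO_log_id_atTop.const_mul_left N).def (c := 1 / 2) (by norm_num)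
  obtain ⟨B, hB⟩ := eventually_atTop.1 h1
  refine ⟨max B (2 * C), fun x hx1 hx => ?_⟩
  by_contra! hlt
  have h2 := hB x ((le_max_left _ _).trans hlt.le)
  have h3 := (le_max_right B (2 * C)).trans_lt hlt
  simp only [Real.norm_eq_abs, id] at h2
  rw [abs_of_nonneg (by linarith : 0 ≤ x)] at h2
  linarith [le_abs_self (N * Real.log x)]

lemma eq_const_of_circle_bounds (hp : Differentiable ℂ p) (hq : Differentiable ℂ q)
    {K : ℝ} {N : ℕ} (hK : 1 ≤ K) (h : ∀ r d : ℝ, 1 ≤ r → 0 < d → d ≤ 1 → ∃ ρ, r ≤ ρ ∧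
      ∀ z, ‖z‖ = ρ → ‖p z‖ ≤ K * (pairGrowth p q (r * (1 + 7 * d)) / d) ^ N ∧
        ‖q z‖ ≤ K * (pairGrowth p q (r * (1 + 7 * d)) / d) ^ N) :
    ∀ z, p z = p 0 ∧ q z = q 0 := by
  set V := pairGrowth p q with hVdef
  have hV1 : ∀ r, 1 ≤ V r := one_le_pairGrowth p q
  have hV : Monotone V := monotone_pairGrowth hp hq
  obtain ⟨B, hB⟩ := exists_bound_of_le_log (1 + Real.log (3 * K) + N * Real.log 14) (2 * N)
  have hbound : ∀ r, V r ≤ B := by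
    intro r₀
    obtain ⟨r, hr, hVr⟩ := exists_borel_radius hV hV1 (le_max_right r₀ 1)
    have hr1 : 1 ≤ r := (le_max_right r₀ 1).trans hr
    refine (hV ((le_max_left r₀ 1).trans hr)).trans (hB _ (hV1 r) ?_)
    have hVp : 0 < V r := by linarith [hV1 r]
    obtain ⟨ρ, hρ, hz⟩ := h r (1 / (7 * V r)) hr1 (by positivity) (by
      rw [div_le_one (by positivity)]; linarith [hV1 r])
    have e1 : 1 + 7 * (1 / (7 * V r)) = 1 + 1 / V r := by field_simp
    rw [e1] at hz
    set X := V (r * (1 + 1 / V r)) / (1 / (7 * V r)) with hX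
    have hX1 : X ≤ 14 * V r ^ 2 := by
      have : X = V (r * (1 + 1 / V r)) * (7 * V r) := by rw [hX]; field_simp
      rw [this]
      nlinarith
    have hX0 : 0 ≤ X := by
      have := hV1 (r * (1 + 1 / V r))
      positivity
    set Y := K * (14 * V r ^ 2) ^ N with hY
    have hXY : K * X ^ N ≤ Y := by rw [hY]; gcongr
    have hY1 : 1 ≤ Y := by
      have : 1 ≤ (14 * V r ^ 2) ^ N := one_le_pow₀ (by nlinarith [hV1 r])
      nlinarith
    have hρ0 : 0 < ρ := by linarith
    have hs : sSup ((fun z => ‖p z‖ + ‖q z‖) '' Metric.closedBall 0 r) ≤ 2 * Y := by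
      refine csSup_le (((Metric.nonempty_closedBall).2 (by linarith)).image _) ?_
      rintro _ ⟨z, hzr, rfl⟩
      have hzr' : ‖z‖ ≤ ρ := by
        have : ‖z‖ ≤ r := by simpa using hzr
        linarith
      have f1 := norm_le_of_norm_le_on_sphere hp hρ0 (fun w hw => (hz w hw).1.trans hXY) hzr'
      have f2 := norm_le_of_norm_le_on_sphere hq hρ0 (fun w hw => (hz w hw).2.trans hXY) hzr'
      simp only
      linarith
    have h0 := pairGrowth_sSup_nonneg p q r
    have h1 : V r ≤ 1 + Real.log (3 * Y) := by
      rw [hVdef]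
      unfold pairGrowth
      gcongr
      linarith
    refine h1.trans (le_of_eq ?_)
    have : 3 * Y = (3 * K) * (14 * V r ^ 2) ^ N := by rw [hY]; ring
    rw [this, Real.log_mul (by positivity) (by positivity), Real.log_pow,
      Real.log_mul (by norm_num : (14 : ℝ) ≠ 0) (by positivity), Real.log_pow]
    push_cast
    ring
  have hpq : ∀ z, ‖p z‖ + ‖q z‖ ≤ Real.exp B := fun z =>
    (norm_add_norm_le_exp_pairGrowth hp hq le_rfl).trans (Real.exp_le_exp.2 (hbound ‖z‖))
  have hbdd : ∀ f : ℂ → ℂ, (∀ z, ‖f z‖ ≤ Real.exp B) → Bornology.IsBounded (range f) := by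
    intro f hf
    refine (Metric.isBounded_closedBall (x := (0 : ℂ)) (r := Real.exp B)).subset ?_
    rintro _ ⟨z, rfl⟩
    simpa using hf z
  refine fun z => ⟨hp.apply_eq_apply_of_bounded (hbdd p fun z => ?_) z 0,
    hq.apply_eq_apply_of_bounded (hbdd q fun z => ?_) z 0⟩
  · linarith [hpq z, norm_nonneg (q z)]
  · linarith [hpq z, norm_nonneg (p z)]

end pairGrowth

/-! ### An algebraic differential relation between entire functions -/

/-- The numerators of the derivatives of `(p / q) ^ n`, with denominators `q ^ (n + i)`. -/
def derivNumer (n : ℕ) (p q : ℂ → ℂ) : ℕ → ℂ → ℂ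
  | 0 => fun z => p z ^ n
  | i + 1 => fun z => q z * deriv (derivNumer n p q i) z
      - ((n : ℂ) + i) * (deriv q z * derivNumer n p q i z)

lemma growthControlled_derivNumer (n : ℕ) {p q : ℂ → ℂ} (hp : Differentiable ℂ p)
    (hq : Differentiable ℂ q) (i : ℕ) :
    GrowthControlled (pairGrowth p q) (derivNumer n p q i) := by
  obtain ⟨h1, h2⟩ := growthControlled_of_pairGrowth hp hq
  have hV := monotone_pairGrowth hp hq
  have hV1 := one_le_pairGrowth p q
  induction i with
  | zero => exact h1.pow hV1 n
  | succ i ih =>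
    exact (h2.mul (ih.deriv hV hV1)).sub hV1 ((GrowthControlled.const hV1 _).mul
      ((h2.deriv hV hV1).mul ih))

lemma norm_le_of_relations {n k : ℕ} (hnk : k + 3 ≤ n) {P : ℕ → ℂ} {L : ℝ}
    (hL : 1 ≤ L) {a b w s : ℂ} (hb : b ≠ 0) (hP0 : P 0 = a ^ n) (hP : ∀ i ≤ k, P i ≠ 0)
    (hs : s = P k - b ^ (n + k)) (hs0 : s ≠ 0) (hw : w = P (k + 1) / (b * s))
    (hwL : ‖w‖ ≤ L) (hE : ∀ i ≤ k, ‖P (i + 1) / (b * P i)‖ ≤ L)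
    (hI : b ^ 2 * a ^ (n - k - 1) * s = P (k + 1) * b ^ (n - k - 1)) :
    ‖a‖ ≤ 2 * L ^ (k + 1) ∧ ‖b‖ ≤ 2 * L ^ (k + 1) := by
  have ha : a ≠ 0 := by
    intro ha
    apply hP 0 (Nat.zero_le k)
    rw [hP0, ha, zero_pow (by omega)]
  set g := a / b with hg
  have hg0 : g ≠ 0 := div_ne_zero ha hb
  have hagb : a = g * b := by rw [hg]; field_simp
  have hPhi : ∀ i ≤ k, ‖P i / b ^ (n + i)‖ ≤ ‖g‖ ^ n * L ^ i := by
    intro i hi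
    induction i with
    | zero => rw [hP0, hg, add_zero, ← div_pow, norm_pow]; simp
    | succ i ih =>
      have e : P (i + 1) / b ^ (n + (i + 1)) = P i / b ^ (n + i) * (P (i + 1) / (b * P i)) := by
        have := hP i (by omega)
        rw [← add_assoc, pow_succ]
        field_simp
      rw [e, norm_mul, pow_succ, ← mul_assoc]
      gcongr
      · exact ih (by omega)
      · exact hE i (by omega)
  have hWrel : w = P k / b ^ (n + k) * (w - P (k + 1) / (b * P k)) := by
    have h1 := hP k le_rfl
    have h2 : w * (b * s) = P (k + 1) := by rw [hw]; field_simp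
    have h3 : P (k + 1) / (b * P k) * (b * P k) = P (k + 1) := by field_simp
    have h4 : P k / b ^ (n + k) * b ^ (n + k) = P k := by field_simp
    set Φ := P k / b ^ (n + k)
    set ε := P (k + 1) / (b * P k)
    have h5 : b ^ (n + k) ≠ 0 := pow_ne_zero _ hb
    have h6 : w * (b * (Φ * b ^ (n + k) - b ^ (n + k))) = ε * (b * (Φ * b ^ (n + k))) := by
      rw [h4, h3, ← hs, h2]
    have h7 : b * b ^ (n + k) * (w - Φ * (w - ε)) = 0 := by linear_combination -h6
    have h8 := (mul_eq_zero.1 h7).resolve_left (mul_ne_zero hb h5)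
    linear_combination h8
  have hwsmall : ‖w‖ ≤ ‖g‖ ^ n * (2 * L ^ (k + 1)) := by
    rw [hWrel, norm_mul]
    calc _ ≤ (‖g‖ ^ n * L ^ k) * (L + L) := by
          gcongr
          · exact hPhi k le_rfl
          · exact (norm_sub_le _ _).trans (add_le_add hwL (hE k le_rfl))
      _ = _ := by ring
  have hLk : L ≤ 2 * L ^ (k + 1) := by
    have : L ^ 1 ≤ L ^ (k + 1) := pow_le_pow_right₀ hL (by omega)
    rw [pow_one] at this
    linarith
  have hqW : b * g ^ (n - k - 1) = w := by
    have h2 : w * (b * s) = P (k + 1) := by rw [hw]; field_simp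
    have h3 : b * s * b ^ (n - k - 1) ≠ 0 := mul_ne_zero (mul_ne_zero hb hs0) (pow_ne_zero _ hb)
    apply mul_left_cancel₀ h3
    rw [hagb, mul_pow, ← h2] at hI
    linear_combination hI
  have hqn : ‖b‖ * ‖g‖ ^ (n - k - 1) = ‖w‖ := by rw [← hqW, norm_mul, norm_pow]
  have hpn : ‖a‖ * ‖g‖ ^ (n - k - 2) = ‖w‖ := by
    rw [← hqn, hagb, norm_mul, show n - k - 1 = (n - k - 2) + 1 by omega, pow_succ]
    ring
  have hgpos : 0 < ‖g‖ := norm_pos_iff.2 hg0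
  have aux : ∀ (x : ℝ) (j : ℕ), 0 ≤ x → j ≤ n → x * ‖g‖ ^ j = ‖w‖ → x ≤ 2 * L ^ (k + 1) := by
    intro x j hx hj h
    rcases le_total 1 ‖g‖ with h1 | h1
    · have : 1 ≤ ‖g‖ ^ j := one_le_pow₀ h1
      nlinarith
    · have h2 : ‖g‖ ^ n ≤ ‖g‖ ^ j := pow_le_pow_of_le_one hgpos.le h1 hj
      have h3 : 0 < ‖g‖ ^ j := by positivity
      refine le_of_mul_le_mul_right ?_ h3
      rw [h, mul_comm (2 * L ^ (k + 1))]
      refine hwsmall.trans ?_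
      gcongr
  exact ⟨aux _ _ (norm_nonneg _) (by omega) hpn, aux _ _ (norm_nonneg _) (by omega) hqn⟩

theorem entire_pair_eq_const {n k : ℕ} (hnk : k + 3 ≤ n) {p q : ℂ → ℂ} (hp : Differentiable ℂ p)
    (hq : Differentiable ℂ q) (hq0 : q 0 ≠ 0) (hP : ∀ i ≤ k, derivNumer n p q i 0 ≠ 0)
    (hs : derivNumer n p q k 0 - q 0 ^ (n + k) ≠ 0)
    (hI : ∀ z, q z ^ 2 * p z ^ (n - k - 1) * (derivNumer n p q k z - q z ^ (n + k)) =
      derivNumer n p q (k + 1) z * q z ^ (n - k - 1)) :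
    ∀ z, p z = p 0 ∧ q z = q 0 := by
  have hV := monotone_pairGrowth hp hq
  have hV1 := one_le_pairGrowth p q
  obtain ⟨gp, gq⟩ := growthControlled_of_pairGrowth hp hq
  have gP := growthControlled_derivNumer n hp hq
  set φ : ℕ → ℂ → ℂ := fun i => if i ≤ k then derivNumer n p q i else
    if i = k + 1 then fun z => derivNumer n p q k z - q z ^ (n + k) else q with hφ
  have φP : ∀ i ≤ k, φ i = derivNumer n p q i := fun i hi => by simp [hφ, hi]
  have φs : φ (k + 1) = fun z => derivNumer n p q k z - q z ^ (n + k) := by simp [hφ]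
  have φq : φ (k + 2) = q := by simp [hφ]
  obtain ⟨K, hK1, hK⟩ := exists_circle_norm_logDeriv_le hV hV1 (k + 3) (φ := φ)
    (fun i hi => by
      rcases le_or_gt i k with h | h
      · rw [φP i h]; exact gP i
      · rcases (by omega : i = k + 1 ∨ i = k + 2) with rfl | rfl
        · rw [φs]; exact (gP k).sub hV1 (gq.pow hV1 _)
        · rw [φq]; exact gq)
    (fun i hi => by
      rcases le_or_gt i k with h | h
      · rw [φP i h]; exact hP i h
      · rcases (by omega : i = k + 1 ∨ i = k + 2) with rfl | rfl
        · rw [φs]; exact hs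
        · rw [φq]; exact hq0)
  have hn1 : (1 : ℝ) ≤ 2 * n := by
    have : (1 : ℝ) ≤ n := by exact_mod_cast (by omega : 1 ≤ n)
    linarith
  refine eq_const_of_circle_bounds hp hq (K := 2 * (2 * n * K) ^ (k + 1)) (N := 6 * (k + 1)) ?_
    fun r d hr hd hd1 => ?_
  · have : 1 ≤ (2 * n * K) ^ (k + 1) := one_le_pow₀ (by nlinarith)
    linarith
  obtain ⟨ρ, hρ, hz⟩ := hK r d hr hd hd1
  refine ⟨ρ, hρ, fun z hzρ => ?_⟩
  have hX := GrowthControlled.one_le_div hV1 (r := r * (1 + 7 * d)) hd hd1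
  set X := pairGrowth p q (r * (1 + 7 * d)) / d with hXdef
  have hX6 : 1 ≤ X ^ 6 := one_le_pow₀ hX
  have hL : 1 ≤ 2 * n * (K * X ^ 6) := by
    have : 1 ≤ K * X ^ 6 := by nlinarith
    nlinarith
  obtain ⟨q1, q2⟩ := hz (k + 2) (by omega) z hzρ
  obtain ⟨s1, s2⟩ := hz (k + 1) (by omega) z hzρ
  rw [φq] at q1 q2
  rw [φs] at s1 s2
  have hcomb : ∀ (x y : ℂ) (m : ℕ), m + 1 ≤ 2 * n → ‖x‖ ≤ K * X ^ 6 → ‖y‖ ≤ K * X ^ 6 →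
      ‖x - m * y‖ ≤ 2 * n * (K * X ^ 6) := by
    intro x y m hm hx hy
    refine (norm_sub_le _ _).trans ?_
    rw [norm_mul, Complex.norm_natCast]
    have h1 : (m : ℝ) + 1 ≤ 2 * n := by exact_mod_cast hm
    have h2 : 0 ≤ K * X ^ 6 := by linarith [norm_nonneg x]
    have h3 : (m : ℝ) * ‖y‖ ≤ m * (K * X ^ 6) := by gcongr
    nlinarith
  have hder : ∀ i, DifferentiableAt ℂ (derivNumer n p q i) z := fun i => (gP i).1 z
  have key := norm_le_of_relations hnk (P := fun i => derivNumer n p q i z)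
    (L := 2 * n * (K * X ^ 6)) hL (a := p z) (b := q z)
    (w := derivNumer n p q (k + 1) z / (q z * (derivNumer n p q k z - q z ^ (n + k))))
    (s := derivNumer n p q k z - q z ^ (n + k)) q1 rfl
    (fun i hi => by
      have := (hz i (by omega) z hzρ).1
      rwa [φP i hi] at this) rfl s1 rfl ?_ (fun i hi => ?_) (hI z)
  · have e : 2 * (2 * (n : ℝ) * (K * X ^ 6)) ^ (k + 1) =
        2 * (2 * n * K) ^ (k + 1) * X ^ (6 * (k + 1)) := by
      rw [pow_mul, ← mul_assoc (2 * (n : ℝ)) K, mul_pow (2 * (n : ℝ) * K)]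
      ring
    rwa [e] at key
  · have e : derivNumer n p q (k + 1) z / (q z * (derivNumer n p q k z - q z ^ (n + k))) =
        logDeriv (fun z => derivNumer n p q k z - q z ^ (n + k)) z - ((n + k : ℕ) : ℂ) *
          logDeriv q z := by
      have hd' : deriv (fun z => derivNumer n p q k z - q z ^ (n + k)) z =
          deriv (derivNumer n p q k) z - ((n + k : ℕ) : ℂ) * q z ^ (n + k - 1) * deriv q z :=
        ((hder k).hasDerivAt.sub ((hq z).hasDerivAt.pow (n + k))).deriv
      rw [logDeriv_apply, logDeriv_apply, hd', derivNumer]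
      have : q z ^ (n + k) = q z ^ (n + k - 1) * q z := by
        rw [← pow_succ]; congr 1; omega
      simp only at s1
      rw [div_sub' s1, div_eq_div_iff (mul_ne_zero q1 s1) s1]
      field_simp
      rw [this]
      push_cast
      ring
    rw [e]
    exact hcomb _ _ _ (by omega) s2 q2
  · have hPi := hz i (by omega) z hzρ
    rw [φP i hi] at hPi
    have e : derivNumer n p q (i + 1) z / (q z * derivNumer n p q i z) =
        logDeriv (derivNumer n p q i) z - ((n + i : ℕ) : ℂ) * logDeriv q z := by
      have := hPi.1
      rw [logDeriv_apply, logDeriv_apply, derivNumer]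
      field_simp
      push_cast
      ring
    rw [e]
    exact hcomb _ _ _ (by omega) hPi.2 q2

/-! ### Meromorphic functions whose power has a derivative omitting a value -/

lemma meromorphicOrderAt_iteratedDeriv {F : ℂ → ℂ} {x : ℂ} {a : ℤ}
    (hF : meromorphicOrderAt F x = a) (k : ℕ) (h : a < 0 ∨ (k : ℤ) ≤ a) :
    meromorphicOrderAt (iteratedDeriv k F) x = ((a - k : ℤ) : WithTop ℤ) := by
  induction k with
  | zero => simpa using hF
  | succ k ih =>
    rw [iteratedDeriv_succ]
    have hne : a - k ≠ 0 := by
      push_cast at h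
      omega
    rw [meromorphicOrderAt_deriv_eq_sub_one (by exact_mod_cast hne) (ih (by push_cast at h; omega))]
    rw [Nat.cast_succ, sub_sub]

lemma analyticAt_iteratedDeriv {F : ℂ → ℂ} {x : ℂ} (hF : AnalyticAt ℂ F x) (k : ℕ) :
    AnalyticAt ℂ (iteratedDeriv k F) x := by
  rw [iteratedDeriv_eq_iterate]
  exact hF.iterated_deriv k

lemma meromorphicAt_iteratedDeriv {F : ℂ → ℂ} {x : ℂ} (hF : MeromorphicAt F x) (k : ℕ) :
    MeromorphicAt (iteratedDeriv k F) x := by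
  rw [iteratedDeriv_eq_iterate]
  exact hF.iterated_deriv

lemma neg_one_le_meromorphicOrderAt_logDeriv {h : ℂ → ℂ} {x : ℂ} (hh : MeromorphicAt h x) :
    -1 ≤ meromorphicOrderAt (logDeriv h) x := by
  by_cases h1 : meromorphicOrderAt h x = 0
  · exact le_trans (by decide) (meromorphicOrderAt_logDeriv_nonneg hh h1)
  by_cases h2 : meromorphicOrderAt h x = ⊤
  · have : meromorphicOrderAt (logDeriv h) x = ⊤ := by
      rw [meromorphicOrderAt_eq_top_iff] at h2 ⊢
      filter_upwards [h2] with z hz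
      simp [logDeriv_apply, hz]
    rw [this]
    exact le_top
  · exact (meromorphicOrderAt_logDeriv_eq_neg_one hh h1 h2).ge

/-- The logarithmic derivative of `(g ^ n)⁽ᵏ⁾ - 1`. -/
def omittedLogDeriv (n k : ℕ) (g : ℂ → ℂ) : ℂ → ℂ :=
  logDeriv fun z => iteratedDeriv k (g ^ n) z - 1

lemma meromorphicAt_omittedLogDeriv (n k : ℕ) {g : ℂ → ℂ} {x : ℂ} (hg : MeromorphicAt g x) :
    MeromorphicAt (omittedLogDeriv n k g) x :=
  ((meromorphicAt_iteratedDeriv (hg.pow n) k).sub (MeromorphicAt.const 1 x)).logDeriv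

lemma omittedLogDeriv_apply (n k : ℕ) (g : ℂ → ℂ) (z : ℂ) : omittedLogDeriv n k g z =
    iteratedDeriv (k + 1) (g ^ n) z / (iteratedDeriv k (g ^ n) z - 1) := by
  rw [omittedLogDeriv, logDeriv_apply, deriv_sub_const, iteratedDeriv_succ]

lemma le_meromorphicOrderAt_omittedLogDeriv {n k : ℕ} (hnk : k + 3 ≤ n) {g : ℂ → ℂ} {x : ℂ}
    (hg : MeromorphicNFAt g x) {a : ℤ} (ha : meromorphicOrderAt g x = a)
    (hne : AnalyticAt ℂ g x → iteratedDeriv k (g ^ n) x ≠ 1) :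
    ((if a < 0 then -1 else if a = 0 then 0 else n * a - k - 1 : ℤ) : WithTop ℤ) ≤
      meromorphicOrderAt (omittedLogDeriv n k g) x := by
  have hgm := hg.meromorphicAt
  have hF : meromorphicOrderAt (g ^ n) x = ((n * a : ℤ) : WithTop ℤ) := by
    rw [meromorphicOrderAt_pow hgm, ha]
    norm_cast
  have hn0 : (0 : ℤ) < n := by omega
  split_ifs with h1 h2
  · exact neg_one_le_meromorphicOrderAt_logDeriv
      ((meromorphicAt_iteratedDeriv (hgm.pow n) k).sub (MeromorphicAt.const 1 x))
  · subst h2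
    have han := hg.meromorphicOrderAt_nonneg_iff_analyticAt.1 ha.ge
    have hFa : ∀ j, AnalyticAt ℂ (iteratedDeriv j (g ^ n)) x := fun j =>
      analyticAt_iteratedDeriv (han.pow n) j
    have : AnalyticAt ℂ (omittedLogDeriv n k g) x := by
      have e : omittedLogDeriv n k g =
          fun z => iteratedDeriv (k + 1) (g ^ n) z / (iteratedDeriv k (g ^ n) z - 1) :=
        funext (omittedLogDeriv_apply n k g)
      rw [e]
      exact (hFa (k + 1)).div ((hFa k).sub analyticAt_const) (sub_ne_zero.2 (hne han))
    exact this.meromorphicOrderAt_nonneg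
  · have ha1 : 1 ≤ a := by omega
    have hna : (n : ℤ) ≤ n * a := by nlinarith
    have hk0 := meromorphicOrderAt_iteratedDeriv hF k (Or.inr (by omega))
    have hk1 := meromorphicOrderAt_iteratedDeriv hF (k + 1) (Or.inr (by push_cast; omega))
    have hkm := meromorphicAt_iteratedDeriv (hgm.pow n) k
    have hkm1 : MeromorphicAt (fun z => iteratedDeriv k (g ^ n) z - 1) x :=
      hkm.sub (MeromorphicAt.const 1 x)
    have hpos : 0 < meromorphicOrderAt (iteratedDeriv k (g ^ n)) x := by
      rw [hk0]
      exact_mod_cast (by omega : 0 < n * a - k)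
    have h0 : meromorphicOrderAt (fun z => iteratedDeriv k (g ^ n) z - 1) x = 0 := by
      rw [← tendsto_ne_zero_iff_meromorphicOrderAt_eq_zero hkm1]
      refine ⟨0 - 1, by norm_num, ?_⟩
      exact (tendsto_zero_of_meromorphicOrderAt_pos hpos).sub tendsto_const_nhds
    have e : omittedLogDeriv n k g =
        iteratedDeriv (k + 1) (g ^ n) * (fun z => iteratedDeriv k (g ^ n) z - 1)⁻¹ := by
      ext z
      rw [omittedLogDeriv_apply, div_eq_mul_inv]
      rfl
    rw [e, meromorphicOrderAt_mul (meromorphicAt_iteratedDeriv (hgm.pow n) (k + 1))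
      hkm1.inv, meromorphicOrderAt_inv, h0, hk1]
    simp only [neg_zero, add_zero]
    exact_mod_cast (by push_cast; omega)

lemma meromorphicOrderAt_nonneg_quotients {n k : ℕ} (hnk : k + 3 ≤ n) {g : ℂ → ℂ} {x : ℂ}
    (hg : MeromorphicNFAt g x) (ha : meromorphicOrderAt g x ≠ ⊤)
    (hne : AnalyticAt ℂ g x → iteratedDeriv k (g ^ n) x ≠ 1) :
    0 ≤ meromorphicOrderAt (omittedLogDeriv n k g * (g ^ (n - k - 1))⁻¹) x ∧
    0 ≤ meromorphicOrderAt (g * (omittedLogDeriv n k g * (g ^ (n - k - 1))⁻¹)) x := by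
  have hgm := hg.meromorphicAt
  obtain ⟨a, ha⟩ := WithTop.ne_top_iff_exists.1 ha
  have key := le_meromorphicOrderAt_omittedLogDeriv hnk hg ha.symm hne
  have hW := meromorphicAt_omittedLogDeriv n k hgm
  obtain ⟨N, rfl⟩ : ∃ N, n = N + 2 + (k + 1) := ⟨n - k - 3, by omega⟩
  have hN : N + 2 + (k + 1) - k - 1 = N + 2 := by omega
  rw [hN, meromorphicOrderAt_mul hgm (hW.mul (hgm.pow _).inv),
    meromorphicOrderAt_mul hW (hgm.pow _).inv, meromorphicOrderAt_inv, meromorphicOrderAt_pow hgm,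
    ← ha]
  generalize meromorphicOrderAt (omittedLogDeriv (N + 2 + (k + 1)) k g) x = w at key ⊢
  induction w using WithTop.recTopCoe with
  | top =>
    have e : ∀ b : ℤ, (⊤ : WithTop ℤ) + -(((N + 2 : ℕ) : WithTop ℤ) * (b : WithTop ℤ)) = ⊤ :=
      fun b => by simp
    rw [e]
    simp
  | coe w =>
    have hw := WithTop.coe_le_coe.1 key
    have e : ∀ b : ℤ, (w : WithTop ℤ) + -(((N + 2 : ℕ) : WithTop ℤ) * (b : WithTop ℤ)) =
        ((w - (N + 2) * b : ℤ) : WithTop ℤ) := by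
      intro b
      rw [sub_eq_add_neg]
      norm_cast
    rw [e]
    have hN0 : (0 : ℤ) ≤ N := by positivity
    have hk0 : (0 : ℤ) ≤ k := by positivity
    have h1 : 0 ≤ w - (N + 2) * a ∧ 0 ≤ a + (w - (N + 2) * a) := by
      split_ifs at hw with h1 h2
      · constructor <;> nlinarith
      · subst h2; constructor <;> linarith
      · have : 1 ≤ a := by omega
        push_cast at hw
        constructor <;> nlinarith
    exact ⟨by exact_mod_cast h1.1, by exact_mod_cast h1.2⟩

lemma eq_const_of_iteratedDeriv_eq_zero {F : ℂ → ℂ} (hF : Differentiable ℂ F) {m : ℕ}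
    (h : iteratedDeriv m F = 0) (h0 : ∀ z, F z ≠ 0) (z : ℂ) : F z = F 0 := by
  have hj : ∀ j, m ≤ j → iteratedDeriv j F = 0 := by
    intro j hj
    induction j, hj using Nat.le_induction with
    | base => exact h
    | succ j _ ih =>
      rw [iteratedDeriv_succ, ih]
      ext z
      simp
  set P : Polynomial ℂ := ∑ j ∈ Finset.range m,
    Polynomial.monomial j ((j.factorial : ℂ)⁻¹ * iteratedDeriv j F 0) with hP
  have hFP : ∀ z, F z = P.eval z := by
    intro z
    rw [← Complex.taylorSeries_eq_of_entire' 0 z hF, tsum_eq_sum (s := Finset.range m)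
      (fun j hj' => by
        rw [hj j (by simpa using hj')]
        simp), hP, Polynomial.eval_finsetSum]
    simp
  have hdeg : P.degree ≤ 0 := by
    by_contra! hlt
    obtain ⟨w, hw⟩ := Complex.exists_root hlt
    exact h0 w (by rw [hFP]; exact hw)
  rw [Polynomial.eq_C_of_degree_le_zero hdeg] at hFP
  rw [hFP, hFP]
  simp

lemma meromorphicOrderAt_ne_top_of_forall {f : ℂ → ℂ} (hf : MeromorphicOn f univ) {y : ℂ}
    (hy : meromorphicOrderAt f y ≠ ⊤) (x : ℂ) : meromorphicOrderAt f x ≠ ⊤ :=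
  hf.meromorphicOrderAt_ne_top_of_isPreconnected isPreconnected_univ (mem_univ y) (mem_univ x) hy

lemma meromorphicOrderAt_ne_top_of_not_const {g : ℂ → ℂ} (hg : MeromorphicNFOn g univ)
    (hnc : ∀ c : ℂ, ¬ g =ᶠ[𝓝[≠] 0] fun _ => c) (x : ℂ) : meromorphicOrderAt g x ≠ ⊤ := by
  refine meromorphicOrderAt_ne_top_of_forall hg.meromorphicOn (y := 0) (fun h => hnc 0 ?_) x
  exact meromorphicOrderAt_eq_top_iff.1 h

lemma meromorphicOrderAt_iteratedDeriv_pow_ne_top {n k : ℕ} (hnk : k + 3 ≤ n) {g : ℂ → ℂ}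
    (hg : MeromorphicNFOn g univ) (hnc : ∀ c : ℂ, ¬ g =ᶠ[𝓝[≠] 0] fun _ => c) (x : ℂ) :
    meromorphicOrderAt (iteratedDeriv (k + 1) (g ^ n)) x ≠ ⊤ := by
  intro htop
  have hFm : MeromorphicOn (iteratedDeriv (k + 1) (g ^ n)) univ := fun z hz =>
    meromorphicAt_iteratedDeriv ((hg hz).meromorphicAt.pow n) _
  have hall : ∀ z, meromorphicOrderAt (iteratedDeriv (k + 1) (g ^ n)) z = ⊤ := by
    intro z
    by_contra hz
    exact meromorphicOrderAt_ne_top_of_forall hFm hz x htop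
  have hord : ∀ z, meromorphicOrderAt g z = 0 := by
    intro z
    have hgz := hg (mem_univ z)
    obtain ⟨a, ha⟩ := WithTop.ne_top_iff_exists.1 (meromorphicOrderAt_ne_top_of_not_const hg hnc z)
    have hF : meromorphicOrderAt (g ^ n) z = ((n * a : ℤ) : WithTop ℤ) := by
      rw [meromorphicOrderAt_pow hgz.meromorphicAt, ← ha]
      norm_cast
    have hn0 : (0 : ℤ) < n := by omega
    rw [← ha]
    by_contra hne
    have ha0 : a ≠ 0 := fun h => hne (by rw [h]; rfl)
    have := meromorphicOrderAt_iteratedDeriv hF (k + 1) (by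
      rcases lt_or_gt_of_ne ha0 with h | h
      · left; nlinarith
      · right
        have : (n : ℤ) * 1 ≤ n * a := by gcongr; omega
        push_cast
        omega)
    rw [hall z] at this
    exact WithTop.top_ne_coe this
  have han : ∀ z, AnalyticAt ℂ g z := fun z =>
    (hg (mem_univ z)).meromorphicOrderAt_nonneg_iff_analyticAt.1 (hord z).ge
  have hne : ∀ z, g z ≠ 0 := fun z => (hg (mem_univ z)).meromorphicOrderAt_eq_zero_iff.1 (hord z)
  have hgd : Differentiable ℂ g := fun z => (han z).differentiableAt
  have hzero : iteratedDeriv (k + 1) (g ^ n) = 0 := by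
    ext z
    have h1 := meromorphicOrderAt_eq_top_iff.1 (hall z)
    have h2 := (analyticAt_iteratedDeriv ((han z).pow n) (k + 1)).frequently_zero_iff_eventually_zero.1
      h1.frequently
    exact h2.self_of_nhds
  have hconst := eq_const_of_iteratedDeriv_eq_zero (hgd.pow n) hzero
    (fun z => pow_ne_zero n (hne z))
  have hbd : ∀ z, ‖g z‖ ≤ 1 + ‖g 0‖ ^ n := by
    intro z
    have h1 := congrArg norm (hconst z)
    simp only [Pi.pow_apply, norm_pow] at h1
    rcases le_total ‖g z‖ 1 with h | h
    · have : 0 ≤ ‖g 0‖ ^ n := by positivity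
      linarith
    · have := le_self_pow₀ h (by omega : n ≠ 0)
      linarith
  have hb : Bornology.IsBounded (range g) := by
    refine (Metric.isBounded_closedBall (x := (0 : ℂ)) (r := 1 + ‖g 0‖ ^ n)).subset ?_
    rintro _ ⟨z, rfl⟩
    simpa using hbd z
  exact hnc (g 0) (Eventually.of_forall fun z => hgd.apply_eq_apply_of_bounded hb z 0)

lemma derivNumer_eq_of_eqOn {n : ℕ} {p q g : ℂ → ℂ} {O : Set ℂ} (hO : IsOpen O)
    (hq : Differentiable ℂ q) (hg : ∀ z ∈ O, AnalyticAt ℂ g z) (hpq : ∀ z ∈ O, p z = g z * q z)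
    (i : ℕ) : ∀ z ∈ O, derivNumer n p q i z = q z ^ (n + i) * iteratedDeriv i (g ^ n) z := by
  induction i with
  | zero =>
    intro z hz
    simp only [derivNumer, hpq z hz, iteratedDeriv_zero, Pi.pow_apply, add_zero]
    ring
  | succ i ih =>
    intro z hz
    have h1 : derivNumer n p q i =ᶠ[𝓝 z] fun w => q w ^ (n + i) * iteratedDeriv i (g ^ n) w := by
      filter_upwards [hO.mem_nhds hz] with w hw using ih w hw
    have h2 := (analyticAt_iteratedDeriv ((hg z hz).pow n) i).differentiableAt.hasDerivAt
    have h3 : deriv (derivNumer n p q i) z = _ :=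
      h1.deriv_eq.trans ((((hq z).hasDerivAt.pow (n + i)).mul h2).deriv)
    rw [derivNumer]
    beta_reduce
    rw [h3, ih z hz, iteratedDeriv_succ]
    rcases Nat.eq_zero_or_pos (n + i) with h | h
    · obtain ⟨rfl, rfl⟩ : n = 0 ∧ i = 0 := by omega
      simp
    · obtain ⟨m, hm⟩ : ∃ m, n + i = m + 1 := ⟨n + i - 1, by omega⟩
      have hm' : (n : ℂ) + i = m + 1 := by exact_mod_cast hm
      rw [← add_assoc, hm, hm']
      simp only [Pi.pow_apply, Nat.add_sub_cancel]
      push_cast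
      ring

lemma derivNumer_comp_add_const (n : ℕ) (p q : ℂ → ℂ) (c : ℂ) (i : ℕ) (z : ℂ) :
    derivNumer n (fun w => p (w + c)) (fun w => q (w + c)) i z = derivNumer n p q i (z + c) := by
  induction i generalizing z with
  | zero => rfl
  | succ i ih =>
    have : derivNumer n (fun w => p (w + c)) (fun w => q (w + c)) i =
        fun w => derivNumer n p q i (w + c) := funext ih
    rw [derivNumer, derivNumer, this]
    beta_reduce
    rw [deriv_comp_add_const, deriv_comp_add_const]

lemma exists_entire_eq_of_meromorphicOrderAt_nonneg {f : ℂ → ℂ} (hf : MeromorphicOn f univ)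
    (h : ∀ z, 0 ≤ meromorphicOrderAt f z) :
    ∃ q : ℂ → ℂ, Differentiable ℂ q ∧ ∀ z, q =ᶠ[𝓝[≠] z] f := by
  have h1 : ∀ z, toMeromorphicNFOn f univ =ᶠ[𝓝[≠] z] f := fun z =>
    hf.toMeromorphicNFOn_eq_self_on_nhdsNE (mem_univ z)
  refine ⟨toMeromorphicNFOn f univ, fun z => ?_, h1⟩
  have := (meromorphicNFOn_toMeromorphicNFOn f univ
    (mem_univ z)).meromorphicOrderAt_nonneg_iff_analyticAt.1
      (by rw [meromorphicOrderAt_congr (h1 z)]; exact h z)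
  exact this.differentiableAt

/-- A meromorphic function in the plane for which `(g ^ n)⁽ᵏ⁾` omits the value `1` is constant
when `n ≥ k + 3`. -/
theorem exists_eventuallyEq_const_of_omits {n k : ℕ} (hnk : k + 3 ≤ n) {g : ℂ → ℂ}
    (hg : MeromorphicNFOn g univ)
    (hne : ∀ z, AnalyticAt ℂ g z → iteratedDeriv k (g ^ n) z ≠ 1) :
    ∃ c : ℂ, g =ᶠ[𝓝[≠] 0] fun _ => c := by
  by_contra! hnc
  have hord := meromorphicOrderAt_ne_top_of_not_const hg hnc
  have hgm : ∀ z, MeromorphicAt g z := fun z => (hg (mem_univ z)).meromorphicAt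
  set U : ℂ → ℂ := omittedLogDeriv n k g * (g ^ (n - k - 1))⁻¹ with hU
  have hUm : ∀ z, MeromorphicAt U z := fun z =>
    (meromorphicAt_omittedLogDeriv n k (hgm z)).mul ((hgm z).pow _).inv
  have hpos := fun z => meromorphicOrderAt_nonneg_quotients hnk (hg (mem_univ z)) (hord z) (hne z)
  obtain ⟨q, hq, hqU⟩ := exists_entire_eq_of_meromorphicOrderAt_nonneg (fun z _ => hUm z)
    fun z => (hpos z).1
  obtain ⟨p, hp, hpU⟩ := exists_entire_eq_of_meromorphicOrderAt_nonneg
    (fun z _ => (hgm z).mul (hUm z)) fun z => (hpos z).2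
  set O : Set ℂ := {z | AnalyticAt ℂ g z} with hOdef
  have hO : IsOpen O := isOpen_analyticAt ℂ g
  have hOev : ∀ z, ∀ᶠ w in 𝓝[≠] z, w ∈ O := fun z => (hgm z).eventually_analyticAt
  have hpq : ∀ z ∈ O, p z = g z * q z := by
    intro z hz
    have h1 : p =ᶠ[𝓝[≠] z] fun w => g w * q w := by
      filter_upwards [hqU z, hpU z] with w h1 h2
      rw [h1, h2]; rfl
    exact (((hp.analyticAt z).frequently_eq_iff_eventually_eq
      ((show AnalyticAt ℂ g z from hz).mul (hq.analyticAt z))).1 h1.frequently).self_of_nhds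
  have hP := derivNumer_eq_of_eqOn (n := n) hO hq (fun z hz => hz) hpq
  have hFne : ∀ i ≤ k + 1, ∀ z, meromorphicOrderAt (iteratedDeriv i (g ^ n)) z ≠ ⊤ := by
    intro i hi
    induction hi using Nat.decreasingInduction with
    | self => exact meromorphicOrderAt_iteratedDeriv_pow_ne_top hnk hg hnc
    | of_succ i hi ih =>
      intro z htop
      apply ih z
      rw [meromorphicOrderAt_eq_top_iff] at htop ⊢
      rw [iteratedDeriv_succ]
      have h2 : iteratedDeriv i (g ^ n) =ᶠ[𝓝[≠] z] fun _ => 0 := htop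
      filter_upwards [h2.nhdsNE_deriv] with w hw
      simpa using hw
  have hgen : ∀ z, ∀ᶠ w in 𝓝[≠] z, w ∈ O ∧ g w ≠ 0 ∧ q w = U w ∧
      ∀ i ≤ k + 1, iteratedDeriv i (g ^ n) w ≠ 0 := by
    intro z
    have h1 : ∀ᶠ w in 𝓝[≠] z, ∀ i ≤ k + 1, iteratedDeriv i (g ^ n) w ≠ 0 := by
      have : ∀ᶠ w in 𝓝[≠] z, ∀ i ∈ Finset.range (k + 2), iteratedDeriv i (g ^ n) w ≠ 0 :=
        (Filter.eventually_all_finset _).2 fun i hi =>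
          (meromorphicOrderAt_ne_top_iff_eventually_ne_zero
            (meromorphicAt_iteratedDeriv ((hgm z).pow n) i)).1
            (hFne i (by have := Finset.mem_range.1 hi; omega) z)
      filter_upwards [this] with w hw i hi using hw i (Finset.mem_range.2 (by omega))
    filter_upwards [hOev z, hqU z, h1,
      (meromorphicOrderAt_ne_top_iff_eventually_ne_zero (hgm z)).1 (hord z)] with w a b c d
    exact ⟨a, d, b, c⟩
  have hUval : ∀ w, U w = iteratedDeriv (k + 1) (g ^ n) w / (iteratedDeriv k (g ^ n) w - 1) *
      (g w ^ (n - k - 1))⁻¹ := by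
    intro w
    rw [hU, Pi.mul_apply, omittedLogDeriv_apply]
    rfl
  have hPd : ∀ i, Differentiable ℂ (derivNumer n p q i) := fun i =>
    (growthControlled_derivNumer n hp hq i).1
  have hI : ∀ z, q z ^ 2 * p z ^ (n - k - 1) * (derivNumer n p q k z - q z ^ (n + k)) =
      derivNumer n p q (k + 1) z * q z ^ (n - k - 1) := by
    intro z
    have hc1 : Continuous fun z =>
        q z ^ 2 * p z ^ (n - k - 1) * (derivNumer n p q k z - q z ^ (n + k)) := by
      have := hq.continuous
      have := hp.continuous
      have := (hPd k).continuous
      fun_prop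
    have hc2 : Continuous fun z => derivNumer n p q (k + 1) z * q z ^ (n - k - 1) := by
      have := hq.continuous
      have := (hPd (k + 1)).continuous
      fun_prop
    have hEq : ∀ᶠ w in 𝓝[≠] z,
        q w ^ 2 * p w ^ (n - k - 1) * (derivNumer n p q k w - q w ^ (n + k)) =
        derivNumer n p q (k + 1) w * q w ^ (n - k - 1) := by
      filter_upwards [hgen z] with w hw
      obtain ⟨h1, h2, h3, -⟩ := hw
      have h4 : iteratedDeriv k (g ^ n) w - 1 ≠ 0 := sub_ne_zero.2 (hne w h1)
      have h5 : q w * g w ^ (n - k - 1) * (iteratedDeriv k (g ^ n) w - 1) =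
          iteratedDeriv (k + 1) (g ^ n) w := by
        rw [h3, hUval]
        field_simp
      rw [hP k w h1, hP (k + 1) w h1, hpq w h1, ← h5, mul_pow]
      ring
    exact tendsto_nhds_unique_of_eventuallyEq (hc1.continuousAt.tendsto.mono_left nhdsWithin_le_nhds)
      (hc2.continuousAt.tendsto.mono_left nhdsWithin_le_nhds) hEq
  obtain ⟨c, hcO, hcg, hcU, hcF⟩ := (hgen 0).exists
  have hqc : q c ≠ 0 := by
    rw [hcU, hUval]
    exact mul_ne_zero (div_ne_zero (hcF _ le_rfl) (sub_ne_zero.2 (hne c hcO)))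
      (inv_ne_zero (pow_ne_zero _ hcg))
  have key := entire_pair_eq_const hnk (p := fun w => p (w + c)) (q := fun w => q (w + c))
    (by fun_prop) (by fun_prop) (by simpa using hqc)
    (fun i hi => by
      rw [derivNumer_comp_add_const, zero_add, hP i c hcO]
      exact mul_ne_zero (pow_ne_zero _ hqc) (hcF i (by omega)))
    (by
      rw [derivNumer_comp_add_const, zero_add, hP k c hcO]
      have : q c ^ (n + k) * (iteratedDeriv k (g ^ n) c - 1) ≠ 0 :=
        mul_ne_zero (pow_ne_zero _ hqc) (sub_ne_zero.2 (hne c hcO))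
      intro h
      apply this
      linear_combination h)
    (fun z => by
      rw [derivNumer_comp_add_const, derivNumer_comp_add_const]
      exact hI (z + c))
  have hpc : ∀ z, p z = p c ∧ q z = q c := fun z => by simpa using key (z - c)
  refine hnc (p c / q c) ?_
  filter_upwards [hOev 0] with w hw
  rw [eq_div_iff hqc]
  have := hpq w hw
  rw [(hpc w).1, (hpc w).2] at this
  exact this.symm

/-! ### Sphere-valued limits of meromorphic functions -/

/-- The inverse of a complex number, as a point of the sphere. -/
def sphereInv (h : ℂ) : OnePoint ℂ := if h = 0 then OnePoint.infty else ((h⁻¹ : ℂ) : OnePoint ℂ)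

/-- `f` is in normal form at `w`, with spherical derivative bounded by `C` there. -/
def SphDerivBound (C : ℝ) (f : ℂ → ℂ) (w : ℂ) : Prop :=
  MeromorphicNFAt f w ∧ (AnalyticAt ℂ f w → ‖deriv f w‖ ≤ C * (1 + ‖f w‖ ^ 2)) ∧
    (AnalyticAt ℂ f⁻¹ w → ‖deriv f⁻¹ w‖ ≤ C * (1 + ‖f⁻¹ w‖ ^ 2))

lemma SphDerivBound.inv {C : ℝ} {f : ℂ → ℂ} {w : ℂ} (h : SphDerivBound C f w) :
    SphDerivBound C f⁻¹ w :=
  ⟨h.1.inv, h.2.2, by rw [inv_inv]; exact h.2.1⟩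

lemma analyticAt_of_frequently_norm_le {f : ℂ → ℂ} {w : ℂ} {B : ℝ} (hf : MeromorphicNFAt f w)
    (h : ∃ᶠ z in 𝓝[≠] w, ‖f z‖ ≤ B) : AnalyticAt ℂ f w := by
  rw [← hf.meromorphicOrderAt_nonneg_iff_analyticAt]
  by_contra! hlt
  have := (tendsto_cobounded_iff_meromorphicOrderAt_neg hf.meromorphicAt).2 hlt
  have h2 := (tendsto_norm_cobounded_atTop.comp this).eventually (eventually_gt_atTop B)
  obtain ⟨z, h3, h4⟩ := (h.and_eventually h2).exists
  exact absurd h3 (not_le.2 h4)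

/-- A function with bounded spherical derivative which is not large at the centre of a small disc
remains bounded on the disc. -/
lemma analyticAt_and_norm_le_of_sphDerivBound {f : ℂ → ℂ} {z₀ : ℂ} {r C : ℝ} (hC : 0 ≤ C)
    (hf : ∀ w ∈ Metric.closedBall z₀ r, SphDerivBound C f w) (hr : 17 * C * r ≤ 1)
    (h0 : AnalyticAt ℂ f z₀) (h0' : ‖f z₀‖ ≤ 2) :
    ∀ w ∈ Metric.closedBall z₀ r, AnalyticAt ℂ f w ∧ ‖f w‖ < 4 := by
  set A : Set ℂ := {w | AnalyticAt ℂ f w ∧ ‖f w‖ < 4} with hA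
  have hAo : IsOpen A := by
    rw [isOpen_iff_mem_nhds]
    rintro w ⟨h1, h2⟩
    exact h1.eventually_analyticAt.and (h1.continuousAt.norm.eventually_lt continuousAt_const h2)
  by_contra! hcon
  obtain ⟨w₁, hw₁, hw₁'⟩ := hcon
  have hE : IsCompact (Metric.closedBall z₀ r \ A) := (isCompact_closedBall z₀ r).diff hAo
  obtain ⟨w, hwE, hwmin⟩ := hE.exists_isMinOn ⟨w₁, hw₁, fun h => absurd h.2 (not_lt.2 (hw₁' h.1))⟩
    (f := fun w => dist w z₀) (by fun_prop)
  have hw0 : w ≠ z₀ := by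
    rintro rfl
    exact hwE.2 ⟨h0, by linarith⟩
  have hd : 0 < dist w z₀ := dist_pos.2 hw0
  have hdr : dist w z₀ ≤ r := hwE.1
  have hball : ∀ v ∈ Metric.ball z₀ (dist w z₀), v ∈ A := by
    intro v hv
    by_contra hvA
    have := hwmin (show v ∈ Metric.closedBall z₀ r \ A from ⟨(Metric.mem_ball.1 hv).le.trans hdr, hvA⟩)
    exact absurd (Metric.mem_ball.1 hv) (not_lt.2 this)
  have h3 : ∀ v ∈ Metric.ball z₀ (dist w z₀), ‖f v‖ ≤ 3 := by
    intro v hv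
    have := (convex_ball z₀ (dist w z₀)).norm_image_sub_le_of_norm_deriv_le (f := f) (C := 17 * C)
      (fun x hx => (hball x hx).1.differentiableAt) (fun x hx => by
        have h1 := (hf x ((Metric.mem_ball.1 hx).le.trans hdr)).2.1 (hball x hx).1
        have h2 := (hball x hx).2
        have h4 : ‖f x‖ ^ 2 ≤ 16 := by nlinarith [norm_nonneg (f x)]
        nlinarith) (Metric.mem_ball_self hd) hv
    have h5 : ‖v - z₀‖ ≤ r := by rw [← dist_eq_norm]; exact (Metric.mem_ball.1 hv).le.trans hdr
    have h6 : 17 * C * ‖v - z₀‖ ≤ 1 :=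
      (mul_le_mul_of_nonneg_left h5 (by positivity)).trans hr
    have h7 := norm_le_norm_add_norm_sub' (f v) (f z₀)
    linarith
  have hcl : w ∈ closure (Metric.ball z₀ (dist w z₀)) := by
    rw [closure_ball _ hd.ne']
    exact Metric.mem_closedBall.2 le_rfl
  have hfr : ∃ᶠ v in 𝓝 w, v ∈ Metric.ball z₀ (dist w z₀) := mem_closure_iff_frequently.1 hcl
  have hfr' : ∃ᶠ v in 𝓝[≠] w, ‖f v‖ ≤ 3 := by
    rw [frequently_nhdsWithin_iff]
    refine hfr.mono fun v hv => ⟨h3 v hv, ?_⟩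
    rintro rfl
    exact absurd (Metric.mem_ball.1 hv) (lt_irrefl _)
  have han := analyticAt_of_frequently_norm_le (hf w hwE.1).1 hfr'
  refine hwE.2 ⟨han, ?_⟩
  by_contra! h4
  have := han.continuousAt.norm.eventually (lt_mem_nhds (show (3 : ℝ) < ‖f w‖ by linarith))
  obtain ⟨v, h5, h6⟩ := (hfr.and_eventually this).exists
  exact absurd (h3 v h5) (not_le.2 h6)

lemma toSphere_of_analyticAt {f : ℂ → ℂ} {w : ℂ} (h : AnalyticAt ℂ f w) :
    toSphere f w = (f w : OnePoint ℂ) := by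
  rw [toSphere, if_neg]
  intro h2
  exact not_tendsto_nhds_of_tendsto_atTop h2 _ (h.continuousAt.norm.tendsto.mono_left inf_le_left)

lemma toSphere_eq_sphereInv {f : ℂ → ℂ} {w : ℂ} (hf : MeromorphicNFAt f w)
    (hord : meromorphicOrderAt f w ≠ ⊤) (h : AnalyticAt ℂ f⁻¹ w) :
    toSphere f w = sphereInv (f⁻¹ w) := by
  by_cases h0 : f⁻¹ w = 0
  · have h1 : meromorphicOrderAt f w < 0 := by
      have h2 : meromorphicOrderAt f⁻¹ w ≠ 0 := fun h3 =>
        ((hf.inv).meromorphicOrderAt_eq_zero_iff.1 h3) h0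
      have h3 := (hf.inv).meromorphicOrderAt_nonneg_iff_analyticAt.2 h
      rw [meromorphicOrderAt_inv] at h2 h3
      lift meromorphicOrderAt f w to ℤ using hord with m
      norm_cast at *
      have : 0 ≤ -m := by exact_mod_cast h3
      have : -m ≠ 0 := by exact_mod_cast h2
      omega
    rw [sphereInv, if_pos h0, toSphere, if_pos]
    exact tendsto_norm_cobounded_atTop.comp
      ((tendsto_cobounded_iff_meromorphicOrderAt_neg hf.meromorphicAt).2 h1)
  · have h1 : AnalyticAt ℂ f w := by simpa using h.inv h0
    rw [toSphere_of_analyticAt h1, sphereInv, if_neg h0]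
    simp

/-- On a small disc, a function with bounded spherical derivative is bounded, or its inverse is. -/
lemma bounded_or_inv_bounded_of_sphDerivBound {f : ℂ → ℂ} {z₀ : ℂ} {r C : ℝ} (hC : 0 ≤ C)
    (hr0 : 0 ≤ r) (hf : ∀ w ∈ Metric.closedBall z₀ r, SphDerivBound C f w) (hr : 17 * C * r ≤ 1) :
    (∀ w ∈ Metric.closedBall z₀ r, AnalyticAt ℂ f w ∧ ‖f w‖ < 4) ∨
    (∀ w ∈ Metric.closedBall z₀ r, AnalyticAt ℂ f⁻¹ w ∧ ‖f⁻¹ w‖ < 4) ∧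
      ∀ w ∈ Metric.closedBall z₀ r, toSphere f w = sphereInv (f⁻¹ w) := by
  have hz : z₀ ∈ Metric.closedBall z₀ r := Metric.mem_closedBall_self hr0
  have hf0 := (hf z₀ hz).1
  by_cases h : AnalyticAt ℂ f z₀ ∧ ‖f z₀‖ ≤ 2
  · exact Or.inl (analyticAt_and_norm_le_of_sphDerivBound hC hf hr h.1 h.2)
  right
  have key : meromorphicOrderAt f z₀ ≠ ⊤ ∧ AnalyticAt ℂ f⁻¹ z₀ ∧ ‖f⁻¹ z₀‖ ≤ 2 := by
    by_cases ha : AnalyticAt ℂ f z₀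
    · have h2 : 2 < ‖f z₀‖ := by by_contra! h2; exact h ⟨ha, h2⟩
      have h3 : f z₀ ≠ 0 := norm_pos_iff.1 (by linarith)
      refine ⟨?_, ha.inv h3, ?_⟩
      · rw [hf0.meromorphicOrderAt_eq_zero_iff.2 h3]; simp
      · rw [Pi.inv_apply, norm_inv]
        exact (inv_le_of_inv_le₀ (by norm_num) (by linarith))
    · have h2 : meromorphicOrderAt f z₀ < 0 := by
        by_contra! h2
        exact ha (hf0.meromorphicOrderAt_nonneg_iff_analyticAt.1 h2)
      have h3 : 0 < meromorphicOrderAt f⁻¹ z₀ := by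
        rw [meromorphicOrderAt_inv]
        lift meromorphicOrderAt f z₀ to ℤ using h2.ne_top with m
        have : m < 0 := by exact_mod_cast h2
        have h4 : 0 < -m := by omega
        exact_mod_cast h4
      refine ⟨h2.ne_top, hf0.inv.meromorphicOrderAt_nonneg_iff_analyticAt.1 h3.le, ?_⟩
      have : f⁻¹ z₀ = 0 := by
        by_contra h5
        exact h3.ne' (hf0.inv.meromorphicOrderAt_eq_zero_iff.2 h5)
      rw [this]; simp
  have h1 := analyticAt_and_norm_le_of_sphDerivBound hC (fun w hw => (hf w hw).inv) hr key.2.1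
    key.2.2
  refine ⟨h1, fun w hw => toSphere_eq_sphereInv (hf w hw).1 ?_ (h1 w hw).1⟩
  have hm : MeromorphicOn f (Metric.closedBall z₀ r) := fun v hv => (hf v hv).1.meromorphicAt
  exact hm.meromorphicOrderAt_ne_top_of_isPreconnected (convex_closedBall z₀ r).isPreconnected hz hw
    key.1

open scoped BoundedContinuousFunction in
/-- Bounded Lipschitz functions on a closed disc. -/
def boundedLipschitz (z : ℂ) (r : ℝ) : Set (Metric.closedBall z (r / 2) →ᵇ ℂ) :=
  {a | (∀ x, a x ∈ Metric.closedBall (0 : ℂ) 4) ∧ LipschitzWith (8 / r).toNNReal a}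

lemma isCompact_closure_boundedLipschitz (z : ℂ) (r : ℝ) :
    IsCompact (closure (boundedLipschitz z r)) := by
  have : CompactSpace (Metric.closedBall z (r / 2)) :=
    isCompact_iff_compactSpace.1 (isCompact_closedBall _ _)
  refine BoundedContinuousFunction.arzela_ascoli (Metric.closedBall (0 : ℂ) 4)
    (isCompact_closedBall _ _) _ (fun a x ha => ha.1 x) ?_
  exact (LipschitzWith.uniformEquicontinuous _ (8 / r).toNNReal fun a => a.2.2).equicontinuous

lemma exists_mem_boundedLipschitz {u : ℂ → ℂ} {z : ℂ} {r : ℝ} (hr : 0 < r)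
    (hu : ∀ w ∈ Metric.closedBall z r, AnalyticAt ℂ u w ∧ ‖u w‖ < 4) :
    ∃ a ∈ boundedLipschitz z r, ∀ x, a x = u x := by
  have hsub : Metric.closedBall z (r / 2) ⊆ Metric.closedBall z r :=
    Metric.closedBall_subset_closedBall (by linarith)
  have hd : ∀ w ∈ Metric.closedBall z (r / 2), ‖deriv u w‖ ≤ 8 / r := by
    intro w hw
    have h1 : Metric.closedBall w (r / 2) ⊆ Metric.closedBall z r := by
      refine Metric.closedBall_subset_closedBall' ?_
      have := Metric.mem_closedBall.1 hw
      linarith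
    have := Complex.norm_deriv_le_of_forall_mem_sphere_norm_le (f := u) (c := w) (R := r / 2)
      (C := 4) (by positivity)
      (DifferentiableOn.diffContOnCl_ball (U := Metric.closedBall z r)
        (fun v hv => (hu v hv).1.differentiableAt.differentiableWithinAt) h1)
      fun v hv => (hu v (h1 (Metric.sphere_subset_closedBall hv))).2.le
    refine this.trans (le_of_eq ?_)
    field_simp
    norm_num
  have hlip : LipschitzWith (8 / r).toNNReal fun x : Metric.closedBall z (r / 2) => u x := by
    refine LipschitzWith.of_dist_le_mul fun x y => ?_
    rw [Real.coe_toNNReal _ (by positivity), dist_eq_norm, Subtype.dist_eq, dist_eq_norm]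
    exact (convex_closedBall z (r / 2)).norm_image_sub_le_of_norm_deriv_le
      (fun v hv => (hu v (hsub hv)).1.differentiableAt) hd y.2 x.2
  refine ⟨BoundedContinuousFunction.ofNormedAddCommGroup _ hlip.continuous 4
    fun x => (hu x (hsub x.2)).2.le, ⟨fun x => ?_, hlip⟩, fun x => rfl⟩
  rw [mem_closedBall_zero_iff]
  exact (hu x (hsub x.2)).2.le

/-- `F j` are eventually analytic on `B` and converge uniformly on `B` to the analytic `u`. -/
def AnalyticConv (F : ℕ → ℂ → ℂ) (u : ℂ → ℂ) (B : Set ℂ) : Prop :=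
  TendstoUniformlyOn F u atTop B ∧ (∀ᶠ j in atTop, ∀ w ∈ B, AnalyticAt ℂ (F j) w) ∧
    ∀ w ∈ B, AnalyticAt ℂ u w

open scoped BoundedContinuousFunction in
lemma exists_analyticConv {F : ℕ → ℂ → ℂ} {z : ℂ} {r : ℝ}
    {a : ℕ → Metric.closedBall z (r / 2) →ᵇ ℂ} {b : Metric.closedBall z (r / 2) →ᵇ ℂ}
    (hab : Tendsto a atTop (𝓝 b))
    (hF : ∀ᶠ j in atTop, ∀ w ∈ Metric.closedBall z (r / 2), AnalyticAt ℂ (F j) w)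
    (haF : ∀ᶠ j in atTop, ∀ x, a j x = F j x) :
    ∃ u, AnalyticConv F u (Metric.ball z (r / 2)) := by
  have hsub : Metric.ball z (r / 2) ⊆ Metric.closedBall z (r / 2) := Metric.ball_subset_closedBall
  set u : ℂ → ℂ := fun w => if h : w ∈ Metric.closedBall z (r / 2) then b ⟨w, h⟩ else 0 with hu
  have h1 : TendstoUniformlyOn F u atTop (Metric.ball z (r / 2)) := by
    rw [Metric.tendstoUniformlyOn_iff]
    intro ε hε
    have := Metric.tendstoUniformly_iff.1
      (BoundedContinuousFunction.tendsto_iff_tendstoUniformly.1 hab) ε hε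
    filter_upwards [this, haF] with j h2 h3 w hw
    have := h2 ⟨w, hsub hw⟩
    rw [h3] at this
    simpa only [hu, dif_pos (hsub hw)] using this
  have h2 : ∀ᶠ j in atTop, ∀ w ∈ Metric.ball z (r / 2), AnalyticAt ℂ (F j) w :=
    hF.mono fun j hj w hw => hj w (hsub hw)
  refine ⟨u, h1, h2, ?_⟩
  have h3 := h1.tendstoLocallyUniformlyOn.differentiableOn
    (h2.mono fun j hj w hw => (hj w hw).differentiableAt.differentiableWithinAt) Metric.isOpen_ball
  exact fun w hw => h3.analyticAt (Metric.isOpen_ball.mem_nhds hw)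

/-- Compactness of sequences with locally bounded spherical derivative. -/
theorem exists_subseq_analyticConv {f : ℕ → ℂ → ℂ} {D : Set ℂ}
    (hf : ∀ z ∈ D, ∃ r > 0, ∃ C ≥ 0, ∀ᶠ j in atTop, ∀ w ∈ Metric.closedBall z r,
      SphDerivBound C (f j) w) :
    ∃ φ : ℕ → ℕ, StrictMono φ ∧ ∀ z ∈ D, ∃ B : Set ℂ, IsOpen B ∧ z ∈ B ∧
      ((∃ u, AnalyticConv (fun j => f (φ j)) u B) ∨
        (∃ u, AnalyticConv (fun j => (f (φ j))⁻¹) u B) ∧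
          ∀ᶠ j in atTop, ∀ w ∈ B, toSphere (f (φ j)) w = sphereInv ((f (φ j))⁻¹ w)) := by
  set P : (ℂ → ℂ) → ℂ → ℝ → Prop := fun f z r =>
    ∀ w ∈ Metric.closedBall z r, AnalyticAt ℂ f w ∧ ‖f w‖ < 4 with hP
  set S : (ℂ → ℂ) → ℂ → ℝ → Prop := fun f z r =>
    ∀ w ∈ Metric.closedBall z r, toSphere f w = sphereInv (f⁻¹ w) with hS
  have hdich : ∀ z, ∃ r : ℝ, 0 < r ∧ (z ∈ D → ∀ᶠ j in atTop,
      P (f j) z r ∨ (P (f j)⁻¹ z r ∧ S (f j) z r)) := by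
    intro z
    by_cases hz : z ∈ D
    · obtain ⟨r, hr, C, hC, hfr⟩ := hf z hz
      refine ⟨min r (1 / (17 * C + 1)), by positivity, fun _ => hfr.mono fun j hj => ?_⟩
      refine bounded_or_inv_bounded_of_sphDerivBound hC (by positivity)
        (fun w hw => hj w (Metric.closedBall_subset_closedBall (min_le_left _ _) hw)) ?_
      calc 17 * C * min r (1 / (17 * C + 1)) ≤ 17 * C * (1 / (17 * C + 1)) := by
            gcongr; exact min_le_right _ _
        _ ≤ 1 := by
            rw [mul_one_div, div_le_one (by positivity)]
            linarith
    · exact ⟨1, one_pos, fun h => absurd h hz⟩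
  choose r hr hdich using hdich
  obtain ⟨t, htD, htc, htU⟩ := TopologicalSpace.countable_cover_nhdsWithin
    (f := fun z => Metric.ball z (r z / 2)) (s := D)
    fun z _ => mem_nhdsWithin_of_mem_nhds (Metric.ball_mem_nhds z (half_pos (hr z)))
  have : Countable t := htc.to_subtype
  have hex : ∀ (i : t) (j : ℕ), ∃ x : Bool × BoundedContinuousFunction
      (Metric.closedBall (i : ℂ) (r i / 2)) ℂ, x.2 ∈ boundedLipschitz (i : ℂ) (r i) ∧
      ((P (f j) i (r i) ∨ (P (f j)⁻¹ i (r i) ∧ S (f j) i (r i))) →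
        (x.1 = true ∧ P (f j) i (r i) ∧ ∀ y, x.2 y = f j y) ∨
        (x.1 = false ∧ P (f j)⁻¹ i (r i) ∧ S (f j) i (r i) ∧ ∀ y, x.2 y = (f j)⁻¹ y)) := by
    intro i j
    by_cases h1 : P (f j) i (r i)
    · obtain ⟨a, ha, hau⟩ := exists_mem_boundedLipschitz (hr i) h1
      exact ⟨(true, a), ha, fun _ => Or.inl ⟨rfl, h1, hau⟩⟩
    · by_cases h2 : P (f j)⁻¹ i (r i) ∧ S (f j) i (r i)
      · obtain ⟨a, ha, hau⟩ := exists_mem_boundedLipschitz (hr i) h2.1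
        exact ⟨(false, a), ha, fun _ => Or.inr ⟨rfl, h2.1, h2.2, hau⟩⟩
      · refine ⟨(true, 0), ⟨fun x => by simp, ?_⟩, fun h => absurd h (by tauto)⟩
        exact (LipschitzWith.const (0 : ℂ)).weaken zero_le
  choose X hX hX' using hex
  obtain ⟨b, -, φ, hφ, hlim⟩ := (isCompact_univ_pi fun i : t =>
    (isCompact_univ (X := Bool)).prod (isCompact_closure_boundedLipschitz (i : ℂ) (r i))).tendsto_subseq
    (x := fun j i => X i j) fun j i _ => ⟨trivial, subset_closure (hX i j)⟩
  refine ⟨φ, hφ, fun z hz => ?_⟩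
  obtain ⟨i, hi, hzi⟩ := mem_iUnion₂.1 (htU hz)
  refine ⟨_, Metric.isOpen_ball, hzi, ?_⟩
  have hl := tendsto_pi_nhds.1 hlim ⟨i, hi⟩
  have hl1 : ∀ᶠ j in atTop, (X ⟨i, hi⟩ (φ j)).1 = (b ⟨i, hi⟩).1 := by
    have := (continuous_fst.tendsto _).comp hl
    rw [nhds_discrete, tendsto_pure] at this
    exact this
  have hl2 : Tendsto (fun j => (X ⟨i, hi⟩ (φ j)).2) atTop (𝓝 (b ⟨i, hi⟩).2) :=
    (continuous_snd.tendsto _).comp hl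
  have hd := (hφ.tendsto_atTop.eventually (hdich i (htD hi))).mono
    fun j hj => hX' ⟨i, hi⟩ (φ j) hj
  have hsub : Metric.closedBall i (r i / 2) ⊆ Metric.closedBall i (r i) :=
    Metric.closedBall_subset_closedBall (by linarith [hr i])
  cases hb : (b ⟨i, hi⟩).1 with
  | true =>
    left
    have hd' := (hd.and hl1).mono fun j hj => hj.1.resolve_right fun h => by
      have := hj.2; rw [h.1, hb] at this; cases this
    exact exists_analyticConv hl2 (hd'.mono fun j hj w hw => (hj.2.1 w (hsub hw)).1)
      (hd'.mono fun j hj => hj.2.2)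
  | false =>
    right
    have hd' := (hd.and hl1).mono fun j hj => hj.1.resolve_left fun h => by
      have := hj.2; rw [h.1, hb] at this; cases this
    exact ⟨exists_analyticConv hl2 (hd'.mono fun j hj w hw => (hj.2.1 w (hsub hw)).1)
      (hd'.mono fun j hj => hj.2.2.2),
      hd'.mono fun j hj w hw => hj.2.2.1 w (hsub (Metric.ball_subset_closedBall hw))⟩

lemma continuous_sphereInv : Continuous sphereInv := by
  rw [continuous_iff_continuousAt]
  intro a
  by_cases ha : a = 0
  · subst ha
    rw [ContinuousAt, show sphereInv 0 = OnePoint.infty from if_pos rfl,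
      ← nhdsNE_sup_pure, tendsto_sup]
    constructor
    · have h1 : Tendsto (fun a : ℂ => ((a⁻¹ : ℂ) : OnePoint ℂ)) (𝓝[≠] 0) (𝓝 OnePoint.infty) := by
        have h2 := (OnePoint.tendsto_coe_infty (X := ℂ))
        rw [coclosedCompact_eq_cocompact, ← Metric.cobounded_eq_cocompact] at h2
        exact h2.comp tendsto_inv₀_nhdsNE_zero
      refine h1.congr' ?_
      filter_upwards [self_mem_nhdsWithin] with a ha
      exact (if_neg ha).symm
    · rw [tendsto_pure_left]
      intro s hs
      have : sphereInv 0 = OnePoint.infty := if_pos rfl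
      rw [this]
      exact mem_of_mem_nhds hs
  · have h1 : ContinuousAt (fun a : ℂ => ((a⁻¹ : ℂ) : OnePoint ℂ)) a :=
      OnePoint.continuous_coe.continuousAt.comp (continuousAt_inv₀ ha)
    refine h1.congr ?_
    filter_upwards [isOpen_ne.mem_nhds ha] with b hb
    exact (if_neg hb).symm

lemma one_le_sqrt_one_add_sq (x : ℝ) : 1 ≤ √(1 + x ^ 2) :=
  Real.one_le_sqrt.2 (by nlinarith [sq_nonneg x])

lemma le_sqrt_one_add_sq (x : ℝ) : x ≤ √(1 + x ^ 2) :=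
  Real.le_sqrt_of_sq_le (by linarith)

lemma sphDist_coe_le (a b : ℂ) : sphDist (a : OnePoint ℂ) (b : OnePoint ℂ) ≤ ‖a - b‖ := by
  change ‖a - b‖ / (√(1 + ‖a‖ ^ 2) * √(1 + ‖b‖ ^ 2)) ≤ _
  exact div_le_self (norm_nonneg _)
    (one_le_mul_of_one_le_of_one_le (one_le_sqrt_one_add_sq _) (one_le_sqrt_one_add_sq _))

lemma one_div_sqrt_one_add_norm_inv_sq_le {a : ℂ} (ha : a ≠ 0) :
    1 / √(1 + ‖a⁻¹‖ ^ 2) ≤ ‖a‖ := by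
  have h1 := le_sqrt_one_add_sq ‖a⁻¹‖
  have h2 : 0 < ‖a⁻¹‖ := norm_pos_iff.2 (inv_ne_zero ha)
  calc 1 / √(1 + ‖a⁻¹‖ ^ 2) ≤ 1 / ‖a⁻¹‖ := one_div_le_one_div_of_le h2 h1
    _ = ‖a‖ := by simp

lemma sphDist_sphereInv_le (a b : ℂ) : sphDist (sphereInv a) (sphereInv b) ≤ ‖a - b‖ := by
  by_cases ha : a = 0 <;> by_cases hb : b = 0
  · subst ha; subst hb
    simp only [sub_zero, norm_zero]
    rw [sphereInv, if_pos rfl]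
    exact le_refl (0 : ℝ)
  · subst ha
    rw [sphereInv, sphereInv, if_pos rfl, if_neg hb, zero_sub, norm_neg]
    exact one_div_sqrt_one_add_norm_inv_sq_le hb
  · subst hb
    rw [sphereInv, sphereInv, if_pos rfl, if_neg ha, sub_zero]
    exact one_div_sqrt_one_add_norm_inv_sq_le ha
  · rw [sphereInv, sphereInv, if_neg ha, if_neg hb]
    change ‖a⁻¹ - b⁻¹‖ / (√(1 + ‖a⁻¹‖ ^ 2) * √(1 + ‖b⁻¹‖ ^ 2)) ≤ _
    have h1 : ‖a⁻¹ - b⁻¹‖ = ‖a - b‖ * (‖a⁻¹‖ * ‖b⁻¹‖) := by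
      rw [← norm_mul, ← norm_mul, ← norm_neg (a⁻¹ - b⁻¹)]
      congr 1
      field_simp
      ring
    rw [h1, div_le_iff₀ (by positivity)]
    gcongr
    · exact le_sqrt_one_add_sq _
    · exact le_sqrt_one_add_sq _

/-- Local description of the limit `G` of a sequence `F` on the sphere. -/
def SphereLimit (F : ℕ → ℂ → ℂ) (G : ℂ → OnePoint ℂ) (D : Set ℂ) : Prop :=
  ∀ z ∈ D, ∃ B : Set ℂ, IsOpen B ∧ z ∈ B ∧
    ((∃ u : ℂ → ℂ, AnalyticConv F u B ∧ ∀ w ∈ B, G w = (u w : OnePoint ℂ)) ∨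
      (∃ u : ℂ → ℂ, AnalyticConv (fun j => (F j)⁻¹) u B ∧
        (∀ᶠ j in atTop, ∀ w ∈ B, toSphere (F j) w = sphereInv ((F j)⁻¹ w)) ∧
          ∀ w ∈ B, G w = sphereInv (u w)))

lemma exists_sphereLimit {F : ℕ → ℂ → ℂ} {D : Set ℂ}
    (h : ∀ z ∈ D, ∃ B : Set ℂ, IsOpen B ∧ z ∈ B ∧
      ((∃ u, AnalyticConv F u B) ∨
        (∃ u, AnalyticConv (fun j => (F j)⁻¹) u B) ∧
          ∀ᶠ j in atTop, ∀ w ∈ B, toSphere (F j) w = sphereInv ((F j)⁻¹ w))) :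
    ∃ G, SphereLimit F G D := by
  refine ⟨fun w => limUnder atTop fun j => toSphere (F j) w, fun z hz => ?_⟩
  obtain ⟨B, hB, hzB, ⟨u, hu⟩ | ⟨⟨u, hu⟩, hs⟩⟩ := h z hz
  · refine ⟨B, hB, hzB, Or.inl ⟨u, hu, fun w hw => ?_⟩⟩
    refine Tendsto.limUnder_eq ?_
    refine ((OnePoint.continuous_coe.tendsto _).comp (hu.1.tendsto_at hw)).congr' ?_
    filter_upwards [hu.2.1] with j hj
    exact (toSphere_of_analyticAt (hj w hw)).symm
  · refine ⟨B, hB, hzB, Or.inr ⟨u, hu, hs, fun w hw => ?_⟩⟩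
    refine Tendsto.limUnder_eq ?_
    refine ((continuous_sphereInv.tendsto _).comp (hu.1.tendsto_at hw)).congr' ?_
    filter_upwards [hs] with j hj
    exact (hj w hw).symm

lemma SphereLimit.eventually_sphDist_lt {F : ℕ → ℂ → ℂ} {G : ℂ → OnePoint ℂ} {D K : Set ℂ}
    (h : SphereLimit F G D) (hKD : K ⊆ D) (hK : IsCompact K) {ε : ℝ} (hε : 0 < ε) :
    ∀ᶠ j in atTop, ∀ z ∈ K, sphDist (toSphere (F j) z) (G z) < ε := by
  refine hK.induction_on (p := fun s => ∀ᶠ j in atTop, ∀ z ∈ s,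
    sphDist (toSphere (F j) z) (G z) < ε) (by simp) (fun s t hst ht => ?_) (fun s t hs ht => ?_) ?_
  · exact ht.mono fun j hj z hz => hj z (hst hz)
  · filter_upwards [hs, ht] with j h1 h2 z hz
    exact hz.elim (h1 z) (h2 z)
  · intro z hz
    obtain ⟨B, hB, hzB, ⟨u, hu, hG⟩ | ⟨u, hu, hs, hG⟩⟩ := h z (hKD hz)
    · refine ⟨B, mem_nhdsWithin_of_mem_nhds (hB.mem_nhds hzB), ?_⟩
      filter_upwards [hu.2.1, Metric.tendstoUniformlyOn_iff.1 hu.1 ε hε] with j h1 h2 w hw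
      rw [toSphere_of_analyticAt (h1 w hw), hG w hw]
      refine (sphDist_coe_le _ _).trans_lt ?_
      rw [← dist_eq_norm, dist_comm]
      exact h2 w hw
    · refine ⟨B, mem_nhdsWithin_of_mem_nhds (hB.mem_nhds hzB), ?_⟩
      filter_upwards [hs, Metric.tendstoUniformlyOn_iff.1 hu.1 ε hε] with j h1 h2 w hw
      rw [h1 w hw, hG w hw]
      refine (sphDist_sphereInv_le _ _).trans_lt ?_
      rw [← dist_eq_norm, dist_comm]
      exact h2 w hw

lemma elim_sphereInv (a : ℂ) : Option.elim (sphereInv a) 0 id = a⁻¹ := by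
  by_cases ha : a = 0
  · simp only [sphereInv, ha, if_true, inv_zero]; rfl
  · simp only [sphereInv, ha, if_false]; rfl

lemma coe_eq_infty_false {a : ℂ} (h : (a : OnePoint ℂ) = OnePoint.infty) : False :=
  OnePoint.coe_ne_infty a h

/-- On a connected set the limit is either identically infinite or a meromorphic function. -/
theorem SphereLimit.eq_infty_or_exists_meromorphicNFOn {F : ℕ → ℂ → ℂ} {G : ℂ → OnePoint ℂ}
    {D : Set ℂ} (h : SphereLimit F G D) (hD : IsPreconnected D) :
    (∀ z ∈ D, G z = OnePoint.infty) ∨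
      ∃ g : ℂ → ℂ, MeromorphicNFOn g D ∧ ∀ z ∈ D, toSphere g z = G z := by
  set S : Set ℂ := {z | ∀ᶠ w in 𝓝 z, G w = OnePoint.infty} with hS
  have hSo : IsOpen S := isOpen_setOfPred_eventually_nhds
  by_cases hne : (D ∩ S).Nonempty
  · left
    have hsub : D ⊆ S := by
      refine hD.subset_of_closure_inter_subset hSo hne ?_
      rintro z ⟨hzS, hzD⟩
      obtain ⟨B, hB, hzB, ⟨u, hu, hG⟩ | ⟨u, hu, hs, hG⟩⟩ := h z hzD
      · obtain ⟨w, hwB, hwS⟩ := mem_closure_iff.1 hzS B hB hzB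
        have := (show ∀ᶠ w in 𝓝 w, G w = OnePoint.infty from hwS).self_of_nhds
        rw [hG w hwB] at this
        exact (coe_eq_infty_false this).elim
      · obtain ⟨r, hr, hrB⟩ := Metric.isOpen_iff.1 hB z hzB
        obtain ⟨w, hwB, hwS⟩ := mem_closure_iff.1 hzS _ Metric.isOpen_ball (Metric.mem_ball_self hr)
        have hu0 : ∀ v ∈ B, G v = OnePoint.infty → u v = 0 := by
          intro v hv hv'
          by_contra hne
          rw [hG v hv, sphereInv, if_neg hne] at hv'
          exact coe_eq_infty_false hv'
        have h1 : u =ᶠ[𝓝 w] 0 := by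
          filter_upwards [show ∀ᶠ w in 𝓝 w, G w = OnePoint.infty from hwS,
            Metric.isOpen_ball.mem_nhds hwB] with v hv hvB using hu0 v (hrB hvB) hv
        have h2 : EqOn u 0 (Metric.ball z r) :=
          AnalyticOnNhd.eqOn_zero_of_preconnected_of_eventuallyEq_zero
            (fun v hv => hu.2.2 v (hrB hv)) (convex_ball z r).isPreconnected hwB h1
        filter_upwards [Metric.ball_mem_nhds z hr] with v hv
        rw [hG v (hrB hv), h2 hv]
        exact if_pos rfl
    exact fun z hz => (show ∀ᶠ w in 𝓝 z, G w = OnePoint.infty from hsub hz).self_of_nhds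
  · right
    set g : ℂ → ℂ := fun z => Option.elim (G z) 0 id with hg
    have key : ∀ z ∈ D, MeromorphicNFAt g z ∧ toSphere g z = G z := by
      intro z hz
      obtain ⟨B, hB, hzB, ⟨u, hu, hG⟩ | ⟨u, hu, hs, hG⟩⟩ := h z hz
      · have h1 : g =ᶠ[𝓝 z] u := by
          filter_upwards [hB.mem_nhds hzB] with w hw
          simp only [hg, hG w hw]; rfl
        have h2 : AnalyticAt ℂ g z := (hu.2.2 z hzB).congr h1.symm
        refine ⟨h2.meromorphicNFAt, ?_⟩
        rw [toSphere_of_analyticAt h2, h1.self_of_nhds, hG z hzB]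
      · have h1 : g =ᶠ[𝓝 z] u⁻¹ := by
          filter_upwards [hB.mem_nhds hzB] with w hw
          simp only [hg, hG w hw, elim_sphereInv]; rfl
        have h1' : g⁻¹ =ᶠ[𝓝 z] u := by simpa using h1.inv
        have h2 : MeromorphicNFAt g z :=
          (meromorphicNFAt_congr h1).2 (hu.2.2 z hzB).meromorphicNFAt.inv
        refine ⟨h2, ?_⟩
        rw [toSphere_eq_sphereInv h2 ?_ ((hu.2.2 z hzB).congr h1'.symm), h1'.self_of_nhds, hG z hzB]
        intro htop
        rw [meromorphicOrderAt_eq_top_iff] at htop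
        have h3 : ∀ᶠ w in 𝓝[≠] z, u w = 0 := by
          filter_upwards [htop, h1.filter_mono nhdsWithin_le_nhds] with w hw hw'
          rw [hw, Pi.inv_apply] at hw'
          exact inv_eq_zero.1 hw'.symm
        have h4 : ∀ᶠ w in 𝓝 z, u w = 0 :=
          (hu.2.2 z hzB).frequently_zero_iff_eventually_zero.1 h3.frequently
        refine hne ⟨z, hz, ?_⟩
        filter_upwards [h4, hB.mem_nhds hzB] with w hw hwB
        rw [hG w hwB, hw]
        exact if_pos rfl
    exact ⟨g, fun z hz => (key z hz).1, fun z hz => (key z hz).2⟩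

lemma tendstoLocallyUniformlyOn_pow {F : ℕ → ℂ → ℂ} {g : ℂ → ℂ} {B : Set ℂ}
    (hF : TendstoLocallyUniformlyOn F g atTop B) (hg : ContinuousOn g B) (n : ℕ) :
    TendstoLocallyUniformlyOn (fun j => F j ^ n) (g ^ n) atTop B := by
  induction n with
  | zero =>
    simp only [pow_zero]
    intro u hu x hx
    exact ⟨B, self_mem_nhdsWithin, Eventually.of_forall fun _ _ _ => refl_mem_uniformity hu⟩
  | succ n ih =>
    simp only [pow_succ]
    exact ih.mul₀ hF (hg.pow n) hg

lemma tendstoLocallyUniformlyOn_iteratedDeriv {F : ℕ → ℂ → ℂ} {g : ℂ → ℂ} {B : Set ℂ}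
    (hB : IsOpen B) (hF : TendstoLocallyUniformlyOn F g atTop B)
    (hd : ∀ᶠ j in atTop, DifferentiableOn ℂ (F j) B) (k : ℕ) :
    TendstoLocallyUniformlyOn (fun j => iteratedDeriv k (F j)) (iteratedDeriv k g) atTop B ∧
      ∀ᶠ j in atTop, DifferentiableOn ℂ (iteratedDeriv k (F j)) B := by
  induction k with
  | zero => simpa only [iteratedDeriv_zero] using ⟨hF, hd⟩
  | succ k ih =>
    simp only [iteratedDeriv_succ]
    exact ⟨ih.1.deriv ih.2 hB, ih.2.mono fun j hj => hj.deriv hB⟩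

/-- **Hurwitz**: a locally uniform limit of zero-free analytic functions which has a zero vanishes
near that zero. -/
lemma eventually_eq_zero_of_tendstoLocallyUniformlyOn {F : ℕ → ℂ → ℂ} {g : ℂ → ℂ} {B : Set ℂ}
    (hB : IsOpen B) (hF : TendstoLocallyUniformlyOn F g atTop B)
    (hd : ∀ᶠ j in atTop, DifferentiableOn ℂ (F j) B)
    (hne : ∀ᶠ j in atTop, ∀ w ∈ B, F j w ≠ 0) {z : ℂ} (hz : z ∈ B) (h0 : g z = 0) :
    ∀ᶠ w in 𝓝 z, g w = 0 := by
  have hgd := hF.differentiableOn hd hB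
  have hga : AnalyticAt ℂ g z := hgd.analyticAt (hB.mem_nhds hz)
  by_contra hcon
  have h1 : ∀ᶠ w in 𝓝[≠] z, g w ≠ 0 :=
    hga.eventually_eq_zero_or_eventually_ne_zero.resolve_left hcon
  rw [eventually_nhdsWithin_iff, Metric.eventually_nhds_iff_ball] at h1
  obtain ⟨R, hR, hR'⟩ := h1
  obtain ⟨R', hR'0, hR'B⟩ := Metric.isOpen_iff.1 hB z hz
  set r := min R R' / 2 with hr
  have hm : 0 < min R R' := lt_min hR hR'0
  have hr0 : 0 < r := by positivity
  have hrR : r < R := by have := min_le_left R R'; linarith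
  have hsub : Metric.closedBall z r ⊆ B :=
    (Metric.closedBall_subset_ball (by have := min_le_right R R'; linarith)).trans hR'B
  have hK : IsCompact (Metric.sphere z r) := isCompact_sphere z r
  have hsne : (Metric.sphere z r).Nonempty := NormedSpace.sphere_nonempty.2 hr0.le
  obtain ⟨w₀, hw₀, hmin⟩ := hK.exists_isMinOn hsne (f := fun w => ‖g w‖)
    ((hgd.continuousOn.mono (Metric.sphere_subset_closedBall.trans hsub)).norm)
  have hpos : 0 < ‖g w₀‖ := by
    refine norm_pos_iff.2 (hR' w₀ ?_ ?_)
    · rw [Metric.mem_ball, Metric.mem_sphere.1 hw₀]; exact hrR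
    · rintro rfl
      simp only [Metric.mem_sphere, dist_self] at hw₀
      exact hr0.ne hw₀
  set m := ‖g w₀‖ / 2 with hmdef
  have hun := (tendstoLocallyUniformlyOn_iff_forall_isCompact hB).1 hF _ hsub
    (isCompact_closedBall z r)
  obtain ⟨j, h2, h3, h4⟩ := ((Metric.tendstoUniformlyOn_iff.1 hun m (by positivity)).and
    (hd.and hne)).exists
  have h5 : ∀ w ∈ Metric.sphere z r, ‖(F j w)⁻¹‖ ≤ m⁻¹ := by
    intro w hw
    rw [norm_inv]
    refine inv_anti₀ (by positivity) ?_
    have h6 := h2 w (Metric.sphere_subset_closedBall hw)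
    rw [dist_eq_norm] at h6
    have h7 : ‖g w₀‖ ≤ ‖g w‖ := hmin hw
    have h8 := norm_le_norm_add_norm_sub' (g w) (F j w)
    linarith
  have h6 : ‖(F j z)⁻¹‖ ≤ m⁻¹ := by
    refine Complex.norm_le_of_forall_mem_frontier_norm_le (f := fun w => (F j w)⁻¹)
      (U := Metric.ball z r) Metric.isBounded_ball ?_ (fun w hw => h5 w ?_)
      (subset_closure (Metric.mem_ball_self hr0))
    · exact ((h3.inv h4).mono hsub).diffContOnCl_ball Subset.rfl
    · rwa [frontier_ball _ hr0.ne'] at hw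
  have h7 := h2 z (Metric.mem_closedBall_self hr0.le)
  rw [dist_eq_norm, h0, zero_sub, norm_neg] at h7
  rw [norm_inv] at h6
  have h8 := (inv_le_inv₀ (norm_pos_iff.2 (h4 z hz)) (by positivity : 0 < m)).1 h6
  linarith

/-- Near a finite value of the limit the convergence is locally uniform. -/
lemma SphereLimit.exists_tendstoLocallyUniformlyOn {F : ℕ → ℂ → ℂ} {G : ℂ → OnePoint ℂ}
    {D : Set ℂ} (h : SphereLimit F G D) (hD : IsOpen D) {g : ℂ → ℂ}
    (hgG : ∀ z ∈ D, toSphere g z = G z) {z : ℂ} (hz : z ∈ D) (hg : AnalyticAt ℂ g z) :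
    ∃ B, IsOpen B ∧ z ∈ B ∧ TendstoLocallyUniformlyOn F g atTop B ∧
      (∀ᶠ j in atTop, ∀ w ∈ B, AnalyticAt ℂ (F j) w) ∧ ∀ w ∈ B, AnalyticAt ℂ g w := by
  set O : Set ℂ := {w | AnalyticAt ℂ g w} ∩ D with hO
  have hOo : IsOpen O := (isOpen_analyticAt ℂ g).inter hD
  have hgO : ∀ w ∈ O, G w = (g w : OnePoint ℂ) := fun w hw => by
    rw [← hgG w hw.2, toSphere_of_analyticAt hw.1]
  obtain ⟨B, hB, hzB, ⟨u, hu, hG⟩ | ⟨u, hu, hs, hG⟩⟩ := h z hz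
  · have hgu : ∀ w ∈ B ∩ O, u w = g w := fun w hw => by
      have := hG w hw.1
      rw [hgO w hw.2] at this
      exact (OnePoint.coe_injective this).symm
    refine ⟨B ∩ O, hB.inter hOo, ⟨hzB, hg, hz⟩, ?_, hu.2.1.mono fun j hj w hw => hj w hw.1,
      fun w hw => hw.2.1⟩
    exact (hu.1.tendstoLocallyUniformlyOn.mono inter_subset_left).congr_right hgu
  · have hgu : ∀ w ∈ B ∩ O, u w ≠ 0 ∧ (u w)⁻¹ = g w := fun w hw => by
      have := hG w hw.1
      rw [hgO w hw.2, sphereInv] at this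
      split_ifs at this with h0
      · exact (OnePoint.coe_ne_infty _ this).elim
      · exact ⟨h0, (OnePoint.coe_injective this).symm⟩
    have hzBO : z ∈ B ∩ O := ⟨hzB, hg, hz⟩
    obtain ⟨R, hR, hRB⟩ := Metric.isOpen_iff.1 (hB.inter hOo) z hzBO
    have hsub : Metric.closedBall z (R / 2) ⊆ B ∩ O :=
      (Metric.closedBall_subset_ball (by linarith)).trans hRB
    have hsub' : Metric.ball z (R / 2) ⊆ B ∩ O := Metric.ball_subset_closedBall.trans hsub
    have hcont : ContinuousOn u B := fun w hw => (hu.2.2 w hw).continuousAt.continuousWithinAt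
    obtain ⟨w₀, hw₀, hmin⟩ := (isCompact_closedBall z (R / 2)).exists_isMinOn
      ⟨z, Metric.mem_closedBall_self (by positivity)⟩ (f := fun w => ‖u w‖)
      (hcont.mono (hsub.trans inter_subset_left)).norm
    have hpos : 0 < ‖u w₀‖ := norm_pos_iff.2 (hgu w₀ (hsub hw₀)).1
    have hne : ∀ᶠ j in atTop, ∀ w ∈ Metric.ball z (R / 2), (F j)⁻¹ w ≠ 0 := by
      filter_upwards [Metric.tendstoUniformlyOn_iff.1 hu.1 _ hpos] with j hj w hw h0
      have h1 := hj w (hsub' hw).1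
      have h1' : (F j)⁻¹ w = 0 := h0
      rw [h1', dist_zero_right] at h1
      have h2 : ‖u w₀‖ ≤ ‖u w‖ := hmin (Metric.ball_subset_closedBall hw)
      exact absurd h1 (not_lt.2 h2)
    refine ⟨Metric.ball z (R / 2), Metric.isOpen_ball, Metric.mem_ball_self (by positivity), ?_, ?_,
      fun w hw => (hsub' hw).2.1⟩
    · have h1 := (hu.1.tendstoLocallyUniformlyOn.mono (hsub'.trans inter_subset_left)).inv₀
        (hcont.mono (hsub'.trans inter_subset_left)) fun w hw => (hgu w (hsub' hw)).1
      refine (h1.congr_right fun w hw => (hgu w (hsub' hw)).2).congr fun j w hw => ?_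
      simp
    · filter_upwards [hu.2.1, hne] with j h1 h2 w hw
      simpa using (h1 w (hsub' hw).1).inv (h2 w hw)

/-- The condition `(fⁿ)⁽ᵏ⁾ ≠ 1` passes to the limit. -/
lemma iteratedDeriv_pow_eventually_eq_one {F : ℕ → ℂ → ℂ} {g : ℂ → ℂ} {B : Set ℂ} {n k : ℕ}
    (hB : IsOpen B) (hF : TendstoLocallyUniformlyOn F g atTop B)
    (hFa : ∀ᶠ j in atTop, ∀ w ∈ B, AnalyticAt ℂ (F j) w) (hg : ∀ w ∈ B, AnalyticAt ℂ g w)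
    {z : ℂ} (hz : z ∈ B)
    (hne : ∀ᶠ j in atTop, ∀ w ∈ B, iteratedDeriv k (F j ^ n) w ≠ 1)
    (h1 : iteratedDeriv k (g ^ n) z = 1) : ∀ᶠ w in 𝓝 z, iteratedDeriv k (g ^ n) w = 1 := by
  have hd : ∀ᶠ j in atTop, DifferentiableOn ℂ (F j ^ n) B := hFa.mono fun j hj w hw =>
    ((hj w hw).pow n).differentiableAt.differentiableWithinAt
  obtain ⟨h2, h3⟩ := tendstoLocallyUniformlyOn_iteratedDeriv hB (tendstoLocallyUniformlyOn_pow hF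
    (fun w hw => (hg w hw).continuousAt.continuousWithinAt) n) hd k
  have h4 : TendstoLocallyUniformlyOn (fun j w => iteratedDeriv k (F j ^ n) w - 1)
      (fun w => iteratedDeriv k (g ^ n) w - 1) atTop B := by
    rw [Metric.tendstoLocallyUniformlyOn_iff] at h2 ⊢
    simpa only [dist_sub_right] using h2
  have := eventually_eq_zero_of_tendstoLocallyUniformlyOn hB h4
    (h3.mono fun j hj => hj.sub_const 1)
    (hne.mono fun j hj w hw => sub_ne_zero.2 (hj w hw)) hz (sub_eq_zero.2 h1)
  exact this.mono fun w hw => sub_eq_zero.1 hw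

/-! ### Rescaling of non-normal sequences -/

/-- The bound `t` for the weighted spherical derivative of exponent `α`. -/
def PangBound (α t : ℝ) (f : ℂ → ℂ) (w : ℂ) : Prop :=
  (AnalyticAt ℂ f w ∧ ‖deriv f w‖ ≤ t ^ (1 - α)) ∨
    (AnalyticAt ℂ f⁻¹ w ∧ ‖deriv f⁻¹ w‖ ≤ t ^ (1 + α))

lemma PangBound.mono {α t s : ℝ} {f : ℂ → ℂ} {w : ℂ} (hα0 : 0 ≤ α) (hα1 : α ≤ 1) (ht : 0 ≤ t)
    (hts : t ≤ s) (h : PangBound α t f w) : PangBound α s f w :=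
  h.imp (fun h => ⟨h.1, h.2.trans (Real.rpow_le_rpow ht hts (by linarith))⟩)
    fun h => ⟨h.1, h.2.trans (Real.rpow_le_rpow ht hts (by linarith))⟩

lemma norm_deriv_le_of_inv {f : ℂ → ℂ} {w : ℂ} {C : ℝ} (hC : 0 ≤ C) (hf : AnalyticAt ℂ f w)
    (hf' : AnalyticAt ℂ f⁻¹ w) (h : ‖deriv f⁻¹ w‖ ≤ C) : ‖deriv f w‖ ≤ C * (1 + ‖f w‖ ^ 2) := by
  by_cases h0 : f w = 0
  · have h1 : ∀ᶠ z in 𝓝 w, ‖f z * f⁻¹ z‖ < 1 := by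
      refine (hf.mul hf').continuousAt.norm.eventually_lt continuousAt_const ?_
      simp [h0]
    have h2 : f =ᶠ[𝓝 w] fun _ => 0 := by
      filter_upwards [h1] with z hz
      by_contra h3
      rw [Pi.inv_apply, mul_inv_cancel₀ h3, norm_one] at hz
      exact lt_irrefl _ hz
    rw [h2.deriv_eq, deriv_const, norm_zero]
    positivity
  · have h1 : deriv f⁻¹ w = -deriv f w / f w ^ 2 := (hf.differentiableAt.hasDerivAt.inv h0).deriv
    rw [h1, norm_div, norm_neg, norm_pow, div_le_iff₀ (by positivity)] at h
    linarith

lemma PangBound.sphDerivBound {α t : ℝ} {f : ℂ → ℂ} {w : ℂ} (hα0 : 0 ≤ α) (hα1 : α ≤ 1)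
    (ht : 0 ≤ t) (hf : MeromorphicNFAt f w) (h : PangBound α t f w) :
    SphDerivBound ((1 + t) ^ 2) f w := by
  have hb : ∀ s : ℝ, 0 ≤ s → s ≤ 2 → t ^ s ≤ (1 + t) ^ 2 := fun s hs0 hs2 =>
    calc t ^ s ≤ (1 + t) ^ s := Real.rpow_le_rpow ht (by linarith) hs0
      _ ≤ (1 + t) ^ (2 : ℝ) := Real.rpow_le_rpow_of_exponent_le (by linarith) hs2
      _ = (1 + t) ^ 2 := Real.rpow_two _
  have hC : 0 ≤ (1 + t) ^ 2 := by positivity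
  have hm : ∀ x : ℝ, (1 + t) ^ 2 ≤ (1 + t) ^ 2 * (1 + x ^ 2) := fun x =>
    le_mul_of_one_le_right hC (by nlinarith [sq_nonneg x])
  rcases h with ⟨h1, h2⟩ | ⟨h1, h2⟩
  · replace h2 := h2.trans (hb (1 - α) (by linarith) (by linarith))
    exact ⟨hf, fun _ => h2.trans (hm _), fun h3 => norm_deriv_le_of_inv hC h3
      (by rwa [inv_inv]) (by rwa [inv_inv])⟩
  · replace h2 := h2.trans (hb (1 + α) (by linarith) (by linarith))
    exact ⟨hf, fun h3 => norm_deriv_le_of_inv hC h3 h1 h2, fun _ => h2.trans (hm _)⟩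

lemma analyticAt_or_analyticAt_inv {f : ℂ → ℂ} {w : ℂ} (hf : MeromorphicNFAt f w) :
    AnalyticAt ℂ f w ∨ AnalyticAt ℂ f⁻¹ w := by
  rcases le_total 0 (meromorphicOrderAt f w) with h | h
  · exact Or.inl (hf.meromorphicOrderAt_nonneg_iff_analyticAt.1 h)
  · refine Or.inr (hf.inv.meromorphicOrderAt_nonneg_iff_analyticAt.1 ?_)
    rw [meromorphicOrderAt_inv]
    lift meromorphicOrderAt f w to ℤ using (h.trans_lt (by simp)).ne with m
    have : m ≤ 0 := by exact_mod_cast h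
    have h4 : 0 ≤ -m := by omega
    exact_mod_cast h4

lemma eventually_norm_deriv_le_rpow {u : ℂ → ℂ} {z : ℂ} (hu : AnalyticAt ℂ u z) {s : ℝ}
    (hs : 0 < s) :
    ∃ t : ℝ, 0 ≤ t ∧ ∀ᶠ w in 𝓝 z, AnalyticAt ℂ u w ∧ ‖deriv u w‖ ≤ t ^ s := by
  refine ⟨(‖deriv u z‖ + 1) ^ s⁻¹, by positivity, ?_⟩
  rw [Real.rpow_inv_rpow (by positivity) hs.ne']
  refine hu.eventually_analyticAt.and ?_
  exact (hu.deriv.continuousAt.norm.eventually_lt continuousAt_const (by simp)).mono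
    fun w hw => le_of_lt hw

lemma exists_forall_pangBound {α : ℝ} (hα0 : 0 ≤ α) (hα1 : α < 1) {f : ℂ → ℂ} {K : Set ℂ}
    (hK : IsCompact K) (hf : MeromorphicNFOn f K) :
    ∃ t : ℝ, 0 ≤ t ∧ ∀ w ∈ K, PangBound α t f w := by
  refine hK.induction_on (p := fun s => ∃ t : ℝ, 0 ≤ t ∧ ∀ w ∈ s, PangBound α t f w)
    ⟨0, le_rfl, by simp⟩ (fun s t hst ht => ?_) (fun s t hs ht => ?_) fun z hz => ?_
  · obtain ⟨c, hc, h⟩ := ht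
    exact ⟨c, hc, fun w hw => h w (hst hw)⟩
  · obtain ⟨c, hc, h⟩ := hs
    obtain ⟨d, hd, h'⟩ := ht
    exact ⟨max c d, le_max_of_le_left hc, fun w hw => hw.elim
      (fun hw => (h w hw).mono hα0 hα1.le hc (le_max_left _ _))
      fun hw => (h' w hw).mono hα0 hα1.le hd (le_max_right _ _)⟩
  · rcases analyticAt_or_analyticAt_inv (hf hz) with h | h
    · obtain ⟨t, ht, h1⟩ := eventually_norm_deriv_le_rpow h (s := 1 - α) (by linarith)
      exact ⟨_, mem_nhdsWithin_of_mem_nhds h1, t, ht, fun w hw => Or.inl hw⟩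
    · obtain ⟨t, ht, h1⟩ := eventually_norm_deriv_le_rpow h (s := 1 + α) (by linarith)
      exact ⟨_, mem_nhdsWithin_of_mem_nhds h1, t, ht, fun w hw => Or.inr hw⟩

/-- The affine change of variables used in rescaling. -/
def affineRescale (c z ρ : ℂ) (f : ℂ → ℂ) : ℂ → ℂ := fun ζ => c * f (z + ρ * ζ)

lemma deriv_affineRescale (c z ρ : ℂ) (f : ℂ → ℂ) (ζ : ℂ) :
    deriv (affineRescale c z ρ f) ζ = c * ρ * deriv f (z + ρ * ζ) := by
  unfold affineRescale
  rw [deriv_const_mul_field, deriv_comp_mul_left ρ (fun x => f (z + x)), deriv_comp_const_add,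
    smul_eq_mul, mul_assoc]

lemma iteratedDeriv_affineRescale (c z ρ : ℂ) (f : ℂ → ℂ) (k : ℕ) :
    iteratedDeriv k (affineRescale c z ρ f) =
      affineRescale (c * ρ ^ k) z ρ (iteratedDeriv k f) := by
  induction k with
  | zero => simp
  | succ k ih =>
    rw [iteratedDeriv_succ, ih]
    funext ζ
    rw [deriv_affineRescale, iteratedDeriv_succ, affineRescale]
    ring

lemma affineRescale_inv (c z ρ : ℂ) (f : ℂ → ℂ) :
    (affineRescale c z ρ f)⁻¹ = affineRescale c⁻¹ z ρ f⁻¹ := by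
  funext ζ
  simp [affineRescale, mul_comm]

lemma affineRescale_pow (c z ρ : ℂ) (f : ℂ → ℂ) (n : ℕ) :
    (affineRescale c z ρ f) ^ n = affineRescale (c ^ n) z ρ (f ^ n) := by
  funext ζ
  simp [affineRescale, mul_pow]

lemma analyticAt_affine (z ρ ζ : ℂ) : AnalyticAt ℂ (fun ζ => z + ρ * ζ) ζ := by fun_prop

lemma MeromorphicNFAt.affineRescale {c z ρ ζ : ℂ} (hc : c ≠ 0) {f : ℂ → ℂ}
    (hf : MeromorphicNFAt f (z + ρ * ζ)) : MeromorphicNFAt (affineRescale c z ρ f) ζ :=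
  (meromorphicNFAt_mul_iff_right (g := fun _ => c) analyticAt_const hc).2
    (MeromorphicNFAt.comp_analyticAt (g := fun ζ => z + ρ * ζ) hf (analyticAt_affine z ρ ζ))

lemma analyticAt_affineRescale_iff {c z ρ ζ : ℂ} (hc : c ≠ 0) (hρ : ρ ≠ 0) {f : ℂ → ℂ} :
    AnalyticAt ℂ (affineRescale c z ρ f) ζ ↔ AnalyticAt ℂ f (z + ρ * ζ) := by
  have hd : deriv (fun ζ => z + ρ * ζ) ζ ≠ 0 := by
    rw [deriv_const_add, deriv_const_mul_field]
    simpa using hρ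
  rw [← show AnalyticAt ℂ (f ∘ fun ζ => z + ρ * ζ) ζ ↔ AnalyticAt ℂ f (z + ρ * ζ) from
    analyticAt_comp_iff_of_deriv_ne_zero (analyticAt_affine z ρ ζ) hd]
  constructor
  · intro h
    have h2 := (analyticAt_const (v := c⁻¹)).mul h
    refine h2.congr (Eventually.of_forall fun w => ?_)
    simp [_root_.affineRescale, hc]
  · exact fun h => (analyticAt_const (v := c)).mul h

lemma pangBound_affineRescale_iff {α t ρ : ℝ} (hρ : 0 < ρ) (ht : 0 ≤ t) {f : ℂ → ℂ} {z ζ : ℂ} :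
    PangBound α (t * ρ) (affineRescale ((ρ ^ (-α) : ℝ) : ℂ) z ρ f) ζ ↔
      PangBound α t f (z + ρ * ζ) := by
  have hρ' : (ρ : ℂ) ≠ 0 := by exact_mod_cast hρ.ne'
  have hp : (0 : ℝ) < ρ ^ (-α) := Real.rpow_pos_of_pos hρ _
  have hc : ((ρ ^ (-α) : ℝ) : ℂ) ≠ 0 := by exact_mod_cast hp.ne'
  unfold PangBound
  rw [affineRescale_inv, analyticAt_affineRescale_iff hc hρ',
    analyticAt_affineRescale_iff (inv_ne_zero hc) hρ', deriv_affineRescale, deriv_affineRescale]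
  have h1 : ‖((ρ ^ (-α) : ℝ) : ℂ) * ρ * deriv f (z + ρ * ζ)‖ =
      ‖deriv f (z + ρ * ζ)‖ * ρ ^ (1 - α) := by
    rw [norm_mul, norm_mul, Complex.norm_real, Complex.norm_real, Real.norm_of_nonneg hp.le,
      Real.norm_of_nonneg hρ.le, mul_comm, sub_eq_neg_add, Real.rpow_add hρ, Real.rpow_one]
  have h2 : ‖((ρ ^ (-α) : ℝ) : ℂ)⁻¹ * ρ * deriv f⁻¹ (z + ρ * ζ)‖ =
      ‖deriv f⁻¹ (z + ρ * ζ)‖ * ρ ^ (1 + α) := by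
    rw [norm_mul, norm_mul, norm_inv, Complex.norm_real, Complex.norm_real,
      Real.norm_of_nonneg hp.le, Real.norm_of_nonneg hρ.le, mul_comm,
      Real.rpow_add hρ, Real.rpow_one, Real.rpow_neg hρ.le, inv_inv]
    ring
  rw [h1, h2, Real.mul_rpow ht hρ.le, Real.mul_rpow ht hρ.le,
    mul_le_mul_iff_left₀ (Real.rpow_pos_of_pos hρ _),
    mul_le_mul_iff_left₀ (Real.rpow_pos_of_pos hρ _)]

/-- Selection of a point around which a local quantity is, up to a factor, maximal. -/
lemma exists_point_of_unbounded {Q : ℝ → ℂ → Prop} {z₀ w₀ : ℂ} {R T t₀ : ℝ} (hR : 0 < R)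
    (hmono : ∀ t s w, 0 ≤ t → t ≤ s → Q t w → Q s w)
    (hT : 0 ≤ T) (hQT : ∀ w ∈ Metric.closedBall z₀ R, Q T w)
    (hw₀ : w₀ ∈ Metric.closedBall z₀ (R / 2)) (ht₀ : 0 < t₀) (hQ : ¬ Q t₀ w₀) :
    ∃ t₁ > 0, ∃ δ > 0, ∃ z₁, ¬ Q t₁ z₁ ∧ Metric.closedBall z₁ δ ⊆ Metric.closedBall z₀ R ∧
      t₀ * R / 8 ≤ t₁ * δ ∧ ∀ w ∈ Metric.closedBall z₁ δ, Q (4 * t₁) w := by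
  set V : Set ℝ := {v | ∃ t w, 0 < t ∧ w ∈ Metric.closedBall z₀ R ∧ ¬ Q t w ∧
    v = t * (R - dist w z₀)} with hV
  have hbdd : BddAbove V := by
    refine ⟨T * R, ?_⟩
    rintro v ⟨t, w, ht, hw, hq, rfl⟩
    have h1 : t ≤ T := by
      by_contra! h
      exact hq (hmono T t w hT h.le (hQT w hw))
    have h2 : 0 ≤ R - dist w z₀ := sub_nonneg.2 hw
    exact mul_le_mul h1 (by linarith [dist_nonneg (x := w) (y := z₀)]) h2 hT
  have hw₀' : dist w₀ z₀ ≤ R / 2 := hw₀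
  have hv₀ : t₀ * (R - dist w₀ z₀) ∈ V :=
    ⟨t₀, w₀, ht₀, Metric.mem_closedBall.2 (by linarith), hQ, rfl⟩
  have hs : t₀ * R / 2 ≤ sSup V :=
    le_trans (by nlinarith) (le_csSup hbdd hv₀)
  have hs0 : 0 < sSup V := lt_of_lt_of_le (by positivity) hs
  obtain ⟨v, ⟨t₁, z₁, ht₁, hz₁, hq₁, rfl⟩, hv⟩ :=
    exists_lt_of_lt_csSup ⟨_, hv₀⟩ (show sSup V / 2 < sSup V by linarith)
  set δ := (R - dist z₁ z₀) / 2 with hδ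
  have hδ0 : 0 < δ := by
    by_contra! h
    have : t₁ * (R - dist z₁ z₀) ≤ 0 := mul_nonpos_of_nonneg_of_nonpos ht₁.le (by linarith)
    linarith
  have hsub : Metric.closedBall z₁ δ ⊆ Metric.closedBall z₀ R :=
    Metric.closedBall_subset_closedBall' (by linarith)
  have hδ' : t₁ * (R - dist z₁ z₀) = 2 * (t₁ * δ) := by rw [hδ]; ring
  refine ⟨t₁, ht₁, δ, hδ0, z₁, hq₁, hsub, by linarith, fun w hw => ?_⟩
  by_contra hq
  have h1 : 4 * t₁ * (R - dist w z₀) ≤ sSup V :=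
    le_csSup hbdd ⟨4 * t₁, w, by positivity, hsub hw, hq, rfl⟩
  have h2 : δ ≤ R - dist w z₀ := by
    have := dist_triangle w z₁ z₀
    have : dist w z₁ ≤ δ := hw
    linarith
  nlinarith

lemma sphereInv_injective : Function.Injective sphereInv := by
  intro a b h
  by_cases ha : a = 0 <;> by_cases hb : b = 0
  · rw [ha, hb]
  · rw [sphereInv, sphereInv, if_pos ha, if_neg hb] at h
    exact (OnePoint.coe_ne_infty _ h.symm).elim
  · rw [sphereInv, sphereInv, if_neg ha, if_pos hb] at h
    exact (OnePoint.coe_ne_infty _ h).elim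
  · rw [sphereInv, sphereInv, if_neg ha, if_neg hb] at h
    exact inv_injective (OnePoint.coe_injective h)

lemma AnalyticConv.le_norm_deriv {F : ℕ → ℂ → ℂ} {u : ℂ → ℂ} {B : Set ℂ} (h : AnalyticConv F u B)
    (hB : IsOpen B) {z : ℂ} (hz : z ∈ B) {m : ℝ} (hm : ∀ᶠ j in atTop, m ≤ ‖deriv (F j) z‖) :
    m ≤ ‖deriv u z‖ := by
  have h1 := h.1.tendstoLocallyUniformlyOn.deriv
    (h.2.1.mono fun j hj w hw => (hj w hw).differentiableAt.differentiableWithinAt) hB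
  exact ge_of_tendsto (h1.tendsto_at hz).norm hm

lemma not_eventually_eq_of_deriv_ne_zero {u : ℂ → ℂ} {G : ℂ → OnePoint ℂ} {σ : ℂ → OnePoint ℂ}
    (hσ : Function.Injective σ) {z : ℂ} (hu : AnalyticAt ℂ u z) (hd : deriv u z ≠ 0)
    (hG : ∀ᶠ w in 𝓝 z, G w = σ (u w)) (c : OnePoint ℂ) : ¬ ∀ᶠ w in 𝓝[≠] z, G w = c := by
  intro h
  have h1 := h.and (hG.filter_mono nhdsWithin_le_nhds)
  obtain ⟨w₀, h2, h3⟩ := h1.exists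
  have h4 : u =ᶠ[𝓝[≠] z] fun _ => u w₀ := by
    filter_upwards [h1] with w hw
    exact hσ (by rw [← hw.2, hw.1, ← h2, h3])
  have h5 : u =ᶠ[𝓝 z] fun _ => u w₀ :=
    (hu.frequently_eq_iff_eventually_eq analyticAt_const).1 h4.frequently
  apply hd
  rw [h5.deriv_eq, deriv_const]

/-- A sequence rescaled as in Zalcman's lemma cannot omit `1` under `g ↦ (g ^ n)⁽ᵏ⁾`. -/
theorem false_of_rescaled_sequence {n k : ℕ} (hnk : k + 3 ≤ n) {α : ℝ} (hα0 : 0 ≤ α)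
    (hα1 : α ≤ 1) {f : ℕ → ℂ → ℂ} {R : ℕ → ℝ} (hR : Tendsto R atTop atTop)
    (hNF : ∀ j, ∀ ζ ∈ Metric.closedBall 0 (R j), MeromorphicNFAt (f j) ζ)
    (hP : ∀ j, ∀ ζ ∈ Metric.closedBall 0 (R j), PangBound α 4 (f j) ζ)
    (h1 : ∀ j, ¬ PangBound α 1 (f j) 0)
    (hne : ∀ j, ∀ ζ ∈ Metric.closedBall 0 (R j), AnalyticAt ℂ (f j) ζ →
      iteratedDeriv k (f j ^ n) ζ ≠ 1) : False := by
  have hsub : ∀ z : ℂ, ∀ᶠ j in atTop, Metric.closedBall z 1 ⊆ Metric.closedBall 0 (R j) := by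
    intro z
    filter_upwards [hR.eventually_ge_atTop (1 + dist z 0)] with j hj
    exact Metric.closedBall_subset_closedBall' hj
  obtain ⟨φ, hφ, hloc⟩ := exists_subseq_analyticConv (f := f) (D := univ) fun z _ =>
    ⟨1, one_pos, (1 + 4) ^ 2, by positivity, (hsub z).mono fun j hj w hw =>
      (hP j w (hj hw)).sphDerivBound hα0 hα1 (by norm_num) (hNF j w (hj hw))⟩
  obtain ⟨G, hG⟩ := exists_sphereLimit hloc
  have hGnc : ∀ c, ¬ ∀ᶠ w in 𝓝[≠] (0 : ℂ), G w = c := by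
    have hd : ∀ j, (AnalyticAt ℂ (f j) 0 → 1 ≤ ‖deriv (f j) 0‖) ∧
        (AnalyticAt ℂ (f j)⁻¹ 0 → 1 ≤ ‖deriv (f j)⁻¹ 0‖) := by
      intro j
      have := h1 j
      unfold PangBound at this
      rw [Real.one_rpow, Real.one_rpow] at this
      push Not at this
      exact ⟨fun h => (this.1 h).le, fun h => (this.2 h).le⟩
    have hpos : ∀ {x : ℂ}, 1 ≤ ‖x‖ → x ≠ 0 := fun h => norm_pos_iff.1 (by linarith)
    obtain ⟨B, hB, hzB, ⟨u, hu, hGu⟩ | ⟨u, hu, hs, hGu⟩⟩ := hG 0 (mem_univ _)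
    · refine not_eventually_eq_of_deriv_ne_zero OnePoint.coe_injective (hu.2.2 0 hzB)
        (hpos (hu.le_norm_deriv hB hzB (hu.2.1.mono fun j hj => (hd (φ j)).1 (hj 0 hzB)))) ?_
      filter_upwards [hB.mem_nhds hzB] with w hw using hGu w hw
    · refine not_eventually_eq_of_deriv_ne_zero sphereInv_injective (hu.2.2 0 hzB)
        (hpos (hu.le_norm_deriv hB hzB (hu.2.1.mono fun j hj => (hd (φ j)).2 (hj 0 hzB)))) ?_
      filter_upwards [hB.mem_nhds hzB] with w hw using hGu w hw
  rcases hG.eq_infty_or_exists_meromorphicNFOn isPreconnected_univ with hinf | ⟨g, hg, hgG⟩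
  · exact hGnc OnePoint.infty (Eventually.of_forall fun w => hinf w (mem_univ w))
  have hnc : ∀ c : ℂ, ¬ g =ᶠ[𝓝[≠] 0] fun _ => c := by
    intro c hc
    have hc' : g =ᶠ[𝓝 0] fun _ => c :=
      ((hg (mem_univ 0)).eventuallyEq_nhdsNE_iff_eventuallyEq_nhds
        analyticAt_const.meromorphicNFAt).1 hc
    refine hGnc (c : OnePoint ℂ) ?_
    filter_upwards [hc'.eventually_nhds.filter_mono nhdsWithin_le_nhds] with w hw
    have hw' : g =ᶠ[𝓝 w] fun _ => c := hw
    rw [← hgG w (mem_univ w), toSphere_of_analyticAt (analyticAt_const.congr hw'.symm),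
      hw'.self_of_nhds]
  obtain ⟨c, hc⟩ := exists_eventuallyEq_const_of_omits hnk hg (k := k) fun z hz hz1 => by
    obtain ⟨B, hB, hzB, hconv, hFa, hga⟩ :=
      hG.exists_tendstoLocallyUniformlyOn isOpen_univ hgG (mem_univ z) hz
    have hev := iteratedDeriv_pow_eventually_eq_one (n := n) (k := k) (z := z)
      (hB.inter (Metric.isOpen_ball (x := z) (ε := 1)))
      (hconv.mono inter_subset_left) (hFa.mono fun j hj w hw => hj w hw.1) (fun w hw => hga w hw.1)
      ⟨hzB, Metric.mem_ball_self one_pos⟩ (by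
        filter_upwards [hFa, hφ.tendsto_atTop.eventually (hsub z)] with j h2 h3 w hw
        exact hne (φ j) w (h3 (Metric.ball_subset_closedBall hw.2)) (h2 w hw.1)) hz1
    refine meromorphicOrderAt_iteratedDeriv_pow_ne_top hnk hg hnc z ?_
    rw [meromorphicOrderAt_eq_top_iff, iteratedDeriv_succ]
    have h2 : iteratedDeriv k (g ^ n) =ᶠ[𝓝 z] fun _ => 1 := hev
    filter_upwards [h2.deriv.filter_mono nhdsWithin_le_nhds] with w hw
    rw [hw, deriv_const]
  exact hnc c hc

lemma exists_rescaled {n k : ℕ} (hn : 0 < n) {α : ℝ} (hα : α = k / n) (hα1 : α < 1)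
    {f : ℂ → ℂ} {z₀ w₀ : ℂ} {R t₀ : ℝ} (hR : 0 < R) (ht₀ : 0 < t₀)
    (hf : MeromorphicNFOn f (Metric.closedBall z₀ R))
    (hne : ∀ z ∈ Metric.closedBall z₀ R, AnalyticAt ℂ f z → iteratedDeriv k (f ^ n) z ≠ 1)
    (hw₀ : w₀ ∈ Metric.closedBall z₀ (R / 2)) (hw₀' : ¬ PangBound α t₀ f w₀) :
    ∃ g : ℂ → ℂ, ∃ r : ℝ, t₀ * R / 8 ≤ r ∧
      (∀ ζ ∈ Metric.closedBall 0 r, MeromorphicNFAt g ζ) ∧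
      (∀ ζ ∈ Metric.closedBall 0 r, PangBound α 4 g ζ) ∧ ¬ PangBound α 1 g 0 ∧
      ∀ ζ ∈ Metric.closedBall 0 r, AnalyticAt ℂ g ζ → iteratedDeriv k (g ^ n) ζ ≠ 1 := by
  have hα0 : 0 ≤ α := by rw [hα]; positivity
  obtain ⟨T, hT, hQT⟩ := exists_forall_pangBound hα0 hα1 (isCompact_closedBall z₀ R) hf
  obtain ⟨t, ht, δ, hδ, z, hq, hsub, hle, hQ⟩ := exists_point_of_unbounded
    (Q := fun t w => PangBound α t f w) hR
    (fun t s w h0 hts h => h.mono hα0 hα1.le h0 hts) hT hQT hw₀ ht₀ hw₀'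
  have hρ : 0 < t⁻¹ := inv_pos.2 ht
  have hc : (((t⁻¹ : ℝ) ^ (-α) : ℝ) : ℂ) ≠ 0 := by
    exact_mod_cast (Real.rpow_pos_of_pos hρ _).ne'
  have hρ' : ((t⁻¹ : ℝ) : ℂ) ≠ 0 := by exact_mod_cast hρ.ne'
  have hmem : ∀ ζ ∈ Metric.closedBall (0 : ℂ) (t * δ),
      z + ((t⁻¹ : ℝ) : ℂ) * ζ ∈ Metric.closedBall z δ := by
    intro ζ hζ
    rw [mem_closedBall_zero_iff] at hζ
    rw [Metric.mem_closedBall, dist_eq_norm, add_sub_cancel_left, norm_mul, Complex.norm_real,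
      Real.norm_of_nonneg hρ.le, inv_mul_le_iff₀ ht]
    exact hζ
  have hcoef : (((t⁻¹ : ℝ) ^ (-α) : ℝ) : ℂ) ^ n * ((t⁻¹ : ℝ) : ℂ) ^ k = 1 := by
    have : ((t⁻¹ : ℝ) ^ (-α)) ^ n * (t⁻¹) ^ k = 1 := by
      rw [← Real.rpow_natCast, ← Real.rpow_mul hρ.le, ← Real.rpow_natCast t⁻¹ k,
        ← Real.rpow_add hρ, hα]
      have hn' : (n : ℝ) ≠ 0 := by positivity
      rw [show -((k : ℝ) / n) * n + k = 0 by field_simp; ring, Real.rpow_zero]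
    exact_mod_cast this
  refine ⟨affineRescale (((t⁻¹ : ℝ) ^ (-α) : ℝ) : ℂ) z (t⁻¹ : ℝ) f, t * δ, hle,
    fun ζ hζ => (hf (hsub (hmem ζ hζ))).affineRescale hc, fun ζ hζ => ?_, ?_, fun ζ hζ ha => ?_⟩
  · have := (pangBound_affineRescale_iff (α := α) hρ (by positivity : 0 ≤ 4 * t)).2
      (hQ _ (hmem ζ hζ))
    rwa [mul_inv_cancel_right₀ ht.ne'] at this
  · intro h
    have h2 := (pangBound_affineRescale_iff (α := α) (t := t) (f := f) (z := z) (ζ := 0) hρ ht.le).1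
      (by rwa [mul_inv_cancel₀ ht.ne'])
    rw [mul_zero, add_zero] at h2
    exact hq h2
  · rw [affineRescale_pow, iteratedDeriv_affineRescale, hcoef, affineRescale, one_mul]
    exact hne _ (hsub (hmem ζ hζ)) ((analyticAt_affineRescale_iff hc hρ').1 ha)

theorem exists_uniform_pangBound {n k : ℕ} (hnk : k + 3 ≤ n) {α : ℝ} (hα : α = k / n)
    {D : Set ℂ} (hD : IsOpen D) {𝓕 : Set (ℂ → ℂ)} (hNF : ∀ f ∈ 𝓕, MeromorphicNFOn f D)
    (hne : ∀ f ∈ 𝓕, ∀ z ∈ D, AnalyticAt ℂ f z → iteratedDeriv k (f ^ n) z ≠ 1)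
    {z₀ : ℂ} (hz₀ : z₀ ∈ D) :
    ∃ r > 0, ∃ T ≥ 0, ∀ f ∈ 𝓕, ∀ w ∈ Metric.closedBall z₀ r, w ∈ D ∧ PangBound α T f w := by
  have hn : 0 < n := by omega
  have hα0 : 0 ≤ α := by rw [hα]; positivity
  have hα1 : α < 1 := by
    rw [hα, div_lt_one (by positivity)]
    exact_mod_cast (by omega : k < n)
  obtain ⟨R, hR, hRD⟩ := Metric.nhds_basis_closedBall.mem_iff.1 (hD.mem_nhds hz₀)
  by_contra! hcon
  have hseq : ∀ m : ℕ, ∃ g : ℂ → ℂ, ∃ r : ℝ, ((m : ℝ) + 1) * R / 8 ≤ r ∧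
      (∀ ζ ∈ Metric.closedBall 0 r, MeromorphicNFAt g ζ) ∧
      (∀ ζ ∈ Metric.closedBall 0 r, PangBound α 4 g ζ) ∧ ¬ PangBound α 1 g 0 ∧
      ∀ ζ ∈ Metric.closedBall 0 r, AnalyticAt ℂ g ζ → iteratedDeriv k (g ^ n) ζ ≠ 1 := by
    intro m
    obtain ⟨f, hf, w, hw, hnP⟩ := hcon (R / 2) (half_pos hR) (m + 1) (by positivity)
    exact exists_rescaled hn hα hα1 hR (by positivity) ((fun z hz => hNF f hf (hRD hz)))
      (fun z hz => hne f hf z (hRD hz)) hw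
      (hnP (hRD (Metric.closedBall_subset_closedBall (by linarith) hw)))
  choose g r hr h1 h2 h3 h4 using hseq
  refine false_of_rescaled_sequence hnk hα0 hα1.le (tendsto_atTop_mono hr ?_) h1 h2 h3 h4
  have : Tendsto (fun m : ℕ => (m : ℝ) + 1) atTop atTop :=
    tendsto_atTop_add_const_right _ _ tendsto_natCast_atTop_atTop
  exact (this.atTop_mul_const hR).atTop_div_const (by norm_num)

lemma toSphere_congr {f g : ℂ → ℂ} {z : ℂ} (h : f =ᶠ[𝓝[≠] z] g)
    (hz : ¬ Tendsto (fun w => ‖f w‖) (𝓝[≠] z) atTop → f z = g z) :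
    toSphere f z = toSphere g z := by
  have h1 : Tendsto (fun w => ‖f w‖) (𝓝[≠] z) atTop ↔ Tendsto (fun w => ‖g w‖) (𝓝[≠] z) atTop :=
    tendsto_congr' (h.mono fun w hw => by simp only [hw])
  unfold toSphere
  by_cases h2 : Tendsto (fun w => ‖f w‖) (𝓝[≠] z) atTop
  · rw [if_pos h2, if_pos (h1.1 h2)]
  · rw [if_neg h2, if_neg (mt h1.2 h2), hz h2]

/-- A normal form agrees with a function near a point where the latter is continuous. -/
lemma eventuallyEq_toMeromorphicNFOn {f : ℂ → ℂ} {D : Set ℂ} (hf : MeromorphicOn f D) {z : ℂ}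
    (hz : z ∈ D) (hc : ContinuousAt f z) : toMeromorphicNFOn f D =ᶠ[𝓝 z] f := by
  have h1 : toMeromorphicNFOn f D =ᶠ[𝓝[≠] z] f := hf.toMeromorphicNFOn_eq_self_on_nhdsNE hz
  have hfa : AnalyticAt ℂ f z := (hf z hz).analyticAt hc
  exact ((meromorphicNFOn_toMeromorphicNFOn f D hz).eventuallyEq_nhdsNE_iff_eventuallyEq_nhds
    hfa.meromorphicNFAt).1 h1

lemma toSphere_toMeromorphicNFOn {f : ℂ → ℂ} {D : Set ℂ} (hf : MeromorphicNiceOn f D) {z : ℂ}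
    (hz : z ∈ D) : toSphere (toMeromorphicNFOn f D) z = toSphere f z :=
  (toSphere_congr (hf.1.toMeromorphicNFOn_eq_self_on_nhdsNE hz).symm fun h =>
    (eventuallyEq_toMeromorphicNFOn hf.1 hz ((hf.2 z hz).resolve_right h)).self_of_nhds.symm).symm

lemma MeromorphicNFOn.meromorphicNiceOn {g : ℂ → ℂ} {D : Set ℂ} (hg : MeromorphicNFOn g D) :
    MeromorphicNiceOn g D := by
  refine ⟨fun z hz => (hg hz).meromorphicAt, fun z hz => ?_⟩
  rcases le_or_gt 0 (meromorphicOrderAt g z) with h | h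
  · exact Or.inl ((hg hz).meromorphicOrderAt_nonneg_iff_analyticAt.1 h).continuousAt
  · exact Or.inr (tendsto_norm_cobounded_atTop.comp
      ((tendsto_cobounded_iff_meromorphicOrderAt_neg (hg hz).meromorphicAt).2 h))

/-- **Schwick's normality criterion.** If `n ≥ k + 3` and every `f` in a family `𝓕` of
meromorphic functions on a domain `D` satisfies `(fⁿ)⁽ᵏ⁾(z) ≠ 1` on `D`,
then `𝓕` is normal in `D`. -/
theorem schwick_normality (n k : ℕ) (hn : 1 ≤ n) (hk : 1 ≤ k) (hnk : k + 3 ≤ n)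
    (D : Set ℂ) (hD : IsOpen D) (hDconn : IsConnected D)
    (𝓕 : Set (ℂ → ℂ)) (hmero : ∀ f ∈ 𝓕, MeromorphicNiceOn f D)
    (hne : ∀ f ∈ 𝓕, ∀ z ∈ D, iteratedDeriv k (f ^ n) z ≠ 1) :
    NormalFamilyOn 𝓕 D := by
  intro f hf
  set f' : ℕ → ℂ → ℂ := fun j => toMeromorphicNFOn (f j) D with hf'
  have hNF : ∀ j, MeromorphicNFOn (f' j) D := fun j => meromorphicNFOn_toMeromorphicNFOn _ _
  have hsph : ∀ j, ∀ z ∈ D, toSphere (f j) z = toSphere (f' j) z := fun j z hz =>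
    (toSphere_toMeromorphicNFOn (hmero _ (hf j)) hz).symm
  have hne' : ∀ j, ∀ z ∈ D, AnalyticAt ℂ (f' j) z → iteratedDeriv k (f' j ^ n) z ≠ 1 := by
    intro j z hz ha
    have hc : ContinuousAt (f j) z := by
      refine ((hmero _ (hf j)).2 z hz).resolve_right fun h => ?_
      have h1 : toSphere (f j) z = OnePoint.infty := if_pos h
      rw [hsph j z hz, toSphere_of_analyticAt ha] at h1
      exact OnePoint.coe_ne_infty _ h1
    have h1 : f' j =ᶠ[𝓝 z] f j := eventuallyEq_toMeromorphicNFOn (hmero _ (hf j)).1 hz hc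
    rw [(h1.pow_const n).iteratedDeriv_eq]
    exact hne _ (hf j) z hz
  have hα0 : (0 : ℝ) ≤ k / n := by positivity
  have hα1 : (k : ℝ) / n ≤ 1 := by
    rw [div_le_one (by positivity)]
    exact_mod_cast (by omega : k ≤ n)
  obtain ⟨φ, hφ, hloc⟩ := exists_subseq_analyticConv (f := f') (D := D) fun z hz => by
    obtain ⟨r, hr, T, hT, hP⟩ := exists_uniform_pangBound hnk rfl hD (𝓕 := range f')
      (by rintro _ ⟨j, rfl⟩; exact hNF j) (by rintro _ ⟨j, rfl⟩; exact hne' j) hz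
    exact ⟨r, hr, (1 + T) ^ 2, by positivity, Eventually.of_forall fun j w hw =>
      (hP _ ⟨j, rfl⟩ w hw).2.sphDerivBound hα0 hα1 hT (hNF j (hP _ ⟨j, rfl⟩ w hw).1)⟩
  obtain ⟨G, hG⟩ := exists_sphereLimit hloc
  refine ⟨φ, hφ, ?_⟩
  rcases hG.eq_infty_or_exists_meromorphicNFOn hDconn.isPreconnected with hinf | ⟨g, hg, hgG⟩
  · right
    intro K hKD hK ε hε
    filter_upwards [hG.eventually_sphDist_lt hKD hK hε] with j hj z hz
    rw [hsph _ z (hKD hz), ← hinf z (hKD hz)]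
    exact hj z hz
  · left
    refine ⟨g, hg.meromorphicNiceOn, fun K hKD hK ε hε => ?_⟩
    filter_upwards [hG.eventually_sphDist_lt hKD hK hε] with j hj z hz
    rw [hsph _ z (hKD hz), hgG z (hKD hz)]
    exact hj z hz

end
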